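/- For every integer ℓ ≥ 2 and all real numbers α ∈ (0,1], ρ ∈ [0,1) and μ ∈ (0,1] there exists δ > 0 (depending only on α, ρ, ℓ, μ) with the following property: for every finite set Ω, every ℓ-step probability distribution P on Ω^ℓ with equal marginals that has an (α,ρ)-convex decomposition, every n ≥ 1, and every function f : Ωⁿ → [0,1] with E[f(X^{(1)})] = μ, one has E[∏_{j=1}^ℓ f(X^{(j)})] ≥ δ. -/

import Mathlib

namespace SameSetHitting

/-- `P` is a probability distribution on a finite type. -/
def IsDist {α : Type} [Fintype α] (P : α → ℝ) : Prop :=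
  (∀ x, 0 ≤ P x) ∧ ∑ x, P x = 1

open Classical in
/-- The `j`-th marginal of an `ℓ`-step distribution `P`. -/
noncomputable def marginal {Ω : Type} [Fintype Ω] {ℓ : ℕ}
    (P : (Fin ℓ → Ω) → ℝ) (j : Fin ℓ) (a : Ω) : ℝ :=
  ∑ x : Fin ℓ → Ω, if x j = a then P x else 0

/-- All `ℓ` marginals of `P` are equal to `π`. -/
def HasMarginals {Ω : Type} [Fintype Ω] {ℓ : ℕ}
    (P : (Fin ℓ → Ω) → ℝ) (π : Ω → ℝ) : Prop :=
  ∀ j a, marginal P j a = π a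

/-- The expectation `E[f(X)]` where `X` has the product law `πⁿ`. -/
noncomputable def exps {Ω : Type} [Fintype Ω] {n : ℕ}
    (π : Ω → ℝ) (f : (Fin n → Ω) → ℝ) : ℝ :=
  ∑ v : Fin n → Ω, (∏ i, π (v i)) * f v

/-- `E[∏_{j} f_j(X^{(j)})]` where the tuples `(X_i^{(1)}, …, X_i^{(ℓ)})`,
`i = 1, …, n`, are i.i.d. with law `P` and `X^{(j)} = (X_1^{(j)}, …, X_n^{(j)})`. -/
noncomputable def prodExp {Ω : Type} [Fintype Ω] {ℓ n : ℕ}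
    (P : (Fin ℓ → Ω) → ℝ) (f : Fin ℓ → ((Fin n → Ω) → ℝ)) : ℝ :=
  ∑ x : Fin ℓ → Fin n → Ω, (∏ i, P (fun j => x j i)) * ∏ j, f j (x j)

/-- Expectation under the single-coordinate multi-step distribution `P`. -/
noncomputable def expP {Ω : Type} [Fintype Ω] {ℓ : ℕ}
    (P : (Fin ℓ → Ω) → ℝ) (f : (Fin ℓ → Ω) → ℝ) : ℝ :=
  ∑ x, P x * f x

/-- Covariance under `P`. -/
noncomputable def covP {Ω : Type} [Fintype Ω] {ℓ : ℕ}
    (P : (Fin ℓ → Ω) → ℝ) (f g : (Fin ℓ → Ω) → ℝ) : ℝ :=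
  expP P (fun x => f x * g x) - expP P f * expP P g

/-- Variance under `P`. -/
noncomputable def varP {Ω : Type} [Fintype Ω] {ℓ : ℕ}
    (P : (Fin ℓ → Ω) → ℝ) (f : (Fin ℓ → Ω) → ℝ) : ℝ :=
  covP P f f

/-- `f` depends only on the coordinates in `S`. -/
def DependsOn {Ω : Type} {ℓ : ℕ} (f : (Fin ℓ → Ω) → ℝ) (S : Finset (Fin ℓ)) : Prop :=
  ∀ x y : Fin ℓ → Ω, (∀ j ∈ S, x j = y j) → f x = f y

/-- The correlation `ρ(P, S, T)`. -/
noncomputable def rhoST {Ω : Type} [Fintype Ω] {ℓ : ℕ}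
    (P : (Fin ℓ → Ω) → ℝ) (S T : Finset (Fin ℓ)) : ℝ :=
  sSup {r : ℝ | ∃ f g : (Fin ℓ → Ω) → ℝ, DependsOn f S ∧ DependsOn g T ∧
    varP P f = 1 ∧ varP P g = 1 ∧ r = covP P f g}

/-- The correlation `ρ(P) = max_j ρ(P, {j}, [ℓ]∖{j})`. -/
noncomputable def rho {Ω : Type} [Fintype Ω] {ℓ : ℕ} (P : (Fin ℓ → Ω) → ℝ) : ℝ :=
  ⨆ j : Fin ℓ, rhoST P {j} ({j}ᶜ)

/-- Expectation under the single-step distribution `π`. -/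
noncomputable def expPi {Ω : Type} [Fintype Ω] (π : Ω → ℝ) (f : Ω → ℝ) : ℝ :=
  ∑ a, π a * f a

/-- Variance under the single-step distribution `π`. -/
noncomputable def varPi {Ω : Type} [Fintype Ω] (π : Ω → ℝ) (f : Ω → ℝ) : ℝ :=
  expPi π (fun a => (f a - expPi π f) ^ 2)

/-- The influence `Inf_i(f(X))` of coordinate `i`, where `X` has product law `πⁿ`. -/
noncomputable def influence {Ω : Type} [Fintype Ω] {n : ℕ}
    (π : Ω → ℝ) (i : Fin n) (f : (Fin n → Ω) → ℝ) : ℝ :=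
  ∑ v : Fin n → Ω, (∏ k, π (v k)) * varPi π (fun a => f (Function.update v i a))

/-- The function obtained from `f` by applying the restriction `R`
(`none` means unrestricted). -/
def restrict {Ω : Type} {n : ℕ} (R : Fin n → Option Ω)
    (f : (Fin n → Ω) → ℝ) : (Fin n → Ω) → ℝ :=
  fun x => f (fun i => (R i).getD (x i))

/-- The size (number of restricted coordinates) of a restriction. -/
def restSize {Ω : Type} {n : ℕ} (R : Fin n → Option Ω) : ℕ :=
  (Finset.univ.filter (fun i => (R i).isSome = true)).card

/-- `f` is `ε`-resilient up to size `k` (with respect to the product law `πⁿ`). -/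
def Resilient {Ω : Type} [Fintype Ω] {n : ℕ} (π : Ω → ℝ) (ε : ℝ) (k : ℕ)
    (f : (Fin n → Ω) → ℝ) : Prop :=
  ∀ R : Fin n → Option Ω, restSize R ≤ k →
    (1 - ε) * exps π f ≤ exps π (restrict R f) ∧
    exps π (restrict R f) ≤ (1 + ε) * exps π f

/-- The restriction operator `R[i,a]`. -/
def restrOp {Ω : Type} {n : ℕ} (i : Fin n) (a : Ω)
    (f : (Fin n → Ω) → ℝ) : (Fin n → Ω) → ℝ :=
  fun x => f (Function.update x i a)

/-- The maximum operator `M[i,y,z]`. -/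
def maxOp {Ω : Type} {n : ℕ} (i : Fin n) (y z : Ω)
    (f : (Fin n → Ω) → ℝ) : (Fin n → Ω) → ℝ :=
  fun x => max (f (Function.update x i y)) (f (Function.update x i z))

/-- Insert the value `a` at position `j` into `w : Ω^{[ℓ] ∖ {j}}`. -/
def ins {Ω : Type} {ℓ : ℕ} (j : Fin ℓ) (w : {k : Fin ℓ // k ≠ j} → Ω) (a : Ω) :
    Fin ℓ → Ω :=
  fun k => if h : k = j then a else w ⟨k, h⟩

/-- The probability that the coordinates other than `j` equal `w`. -/
noncomputable def margOff {Ω : Type} [Fintype Ω] {ℓ : ℕ}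
    (P : (Fin ℓ → Ω) → ℝ) (j : Fin ℓ) (w : {k : Fin ℓ // k ≠ j} → Ω) : ℝ :=
  ∑ a, P (ins j w a)

open Classical in
/-- The joint law of `(Y, Z)` for a double sample on step `j` from `P`. -/
noncomputable def doubleSample {Ω : Type} [Fintype Ω] {ℓ : ℕ}
    (P : (Fin ℓ → Ω) → ℝ) (j : Fin ℓ) (y z : Ω) : ℝ :=
  ∑ w : {k : Fin ℓ // k ≠ j} → Ω,
    if margOff P j w = 0 then 0
    else P (ins j w y) * P (ins j w z) / margOff P j w


/-- `P` has an `(α, ρ)`-convex decomposition. -/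
def HasConvexDecomp {Ω : Type} [Fintype Ω] {ℓ : ℕ} (P : (Fin ℓ → Ω) → ℝ)
    (α ρ : ℝ) : Prop :=
  ∃ (r : ℕ) (β : Fin r → ℝ) (Q : Fin r → ((Fin ℓ → Ω) → ℝ)),
    (∀ k, 0 < β k) ∧ (∑ k, β k = 1) ∧
    (∀ x, P x = ∑ k, β k * Q k x) ∧
    (∀ k, IsDist (Q k)) ∧
    (∀ k, ∃ πk : Ω → ℝ, HasMarginals (Q k) πk) ∧
    (∀ k (x : Ω), α ≤ Q k (fun _ => x)) ∧
    (∀ k, rho (Q k) ≤ ρ)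


set_option linter.unusedSectionVars false
set_option linter.unusedVariables false

/-! ### Product expectations and product operators -/

section basics

noncomputable def ev {n : ℕ} {A : Type} [Fintype A] (ν : Fin n → A → ℝ)
    (g : (Fin n → A) → ℝ) : ℝ :=
  ∑ z, (∏ i, ν i (z i)) * g z

noncomputable def op {n : ℕ} {A B : Type} [Fintype B] (k : Fin n → A → B → ℝ)
    (g : (Fin n → B) → ℝ) (z : Fin n → A) : ℝ :=
  ∑ w, (∏ i, k i (z i) (w i)) * g w

variable {n : ℕ} {A B C : Type} [Fintype A] [Fintype B] [Fintype C]

lemma ev_mono {ν : Fin n → A → ℝ} (h0 : ∀ i a, 0 ≤ ν i a) {g h : (Fin n → A) → ℝ}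
    (hgh : ∀ z, g z ≤ h z) : ev ν g ≤ ev ν h := by
  unfold ev
  exact Finset.sum_le_sum fun z _ =>
    mul_le_mul_of_nonneg_left (hgh z) (Finset.prod_nonneg fun i _ => h0 i _)

lemma ev_nonneg {ν : Fin n → A → ℝ} (h0 : ∀ i a, 0 ≤ ν i a) {g : (Fin n → A) → ℝ}
    (hg : ∀ z, 0 ≤ g z) : 0 ≤ ev ν g := by
  unfold ev
  exact Finset.sum_nonneg fun z _ =>
    mul_nonneg (Finset.prod_nonneg fun i _ => h0 i _) (hg z)

lemma ev_add (ν : Fin n → A → ℝ) (g h : (Fin n → A) → ℝ) :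
    ev ν (fun z => g z + h z) = ev ν g + ev ν h := by
  simp only [ev, mul_add, Finset.sum_add_distrib]

lemma ev_sub (ν : Fin n → A → ℝ) (g h : (Fin n → A) → ℝ) :
    ev ν (fun z => g z - h z) = ev ν g - ev ν h := by
  simp only [ev, mul_sub, Finset.sum_sub_distrib]

lemma ev_smul (ν : Fin n → A → ℝ) (c : ℝ) (g : (Fin n → A) → ℝ) :
    ev ν (fun z => c * g z) = c * ev ν g := by
  simp only [ev, Finset.mul_sum]
  exact Finset.sum_congr rfl fun z _ => by ring

lemma ev_sum {I : Type} (s : Finset I) (ν : Fin n → A → ℝ) (g : I → (Fin n → A) → ℝ) :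
    ev ν (fun z => ∑ b ∈ s, g b z) = ∑ b ∈ s, ev ν (g b) := by
  simp only [ev, Finset.mul_sum]
  exact Finset.sum_comm

lemma sum_prod_pi (φ : Fin n → A → ℝ) :
    ∑ z : Fin n → A, ∏ i, φ i (z i) = ∏ i, ∑ a, φ i a := by
  rw [Finset.prod_univ_sum, Fintype.piFinset_univ]

lemma ev_const {ν : Fin n → A → ℝ} (h1 : ∀ i, ∑ a, ν i a = 1) (c : ℝ) :
    ev ν (fun _ => c) = c := by
  simp only [ev]
  rw [← Finset.sum_mul, sum_prod_pi]
  simp [h1]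

lemma op_mono {k : Fin n → A → B → ℝ} (h0 : ∀ i a b, 0 ≤ k i a b) {g h : (Fin n → B) → ℝ}
    (hgh : ∀ z, g z ≤ h z) (z : Fin n → A) : op k g z ≤ op k h z := by
  unfold op
  exact Finset.sum_le_sum fun w _ =>
    mul_le_mul_of_nonneg_left (hgh w) (Finset.prod_nonneg fun i _ => h0 i _ _)

lemma op_const {k : Fin n → A → B → ℝ} (h1 : ∀ i a, ∑ b, k i a b = 1) (c : ℝ)
    (z : Fin n → A) : op k (fun _ => c) z = c := by
  simp only [op]
  rw [← Finset.sum_mul, sum_prod_pi (fun i b => k i (z i) b)]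
  simp [h1]

lemma op_sub (k : Fin n → A → B → ℝ) (g h : (Fin n → B) → ℝ) (z : Fin n → A) :
    op k (fun w => g w - h w) z = op k g z - op k h z := by
  simp only [op, mul_sub, Finset.sum_sub_distrib]

lemma op_smul (k : Fin n → A → B → ℝ) (c : ℝ) (g : (Fin n → B) → ℝ) (z : Fin n → A) :
    op k (fun w => c * g w) z = c * op k g z := by
  simp only [op, Finset.mul_sum]
  exact Finset.sum_congr rfl fun z _ => by ring

lemma op_sum {I : Type} (s : Finset I) (k : Fin n → A → B → ℝ) (g : I → (Fin n → B) → ℝ)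
    (z : Fin n → A) :
    op k (fun w => ∑ b ∈ s, g b w) z = ∑ b ∈ s, op k (g b) z := by
  simp only [op, Finset.mul_sum]
  exact Finset.sum_comm

lemma op_mem {k : Fin n → A → B → ℝ} (h0 : ∀ i a b, 0 ≤ k i a b)
    (h1 : ∀ i a, ∑ b, k i a b = 1) {g : (Fin n → B) → ℝ}
    (hg : ∀ w, g w ∈ Set.Icc (0:ℝ) 1) (z : Fin n → A) : op k g z ∈ Set.Icc (0:ℝ) 1 := by
  constructor
  · have := op_mono h0 (fun w => (hg w).1) z
    rwa [op_const h1] at this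
  · have := op_mono h0 (fun w => (hg w).2) z
    rwa [op_const h1] at this

lemma op_comp (k : Fin n → A → B → ℝ) (l : Fin n → B → C → ℝ) (g : (Fin n → C) → ℝ)
    (z : Fin n → A) :
    op k (op l g) z = op (fun i a c => ∑ b, k i a b * l i b c) g z := by
  simp only [op]
  simp_rw [Finset.mul_sum]
  rw [Finset.sum_comm]
  refine Finset.sum_congr rfl fun w _ => ?_
  rw [← sum_prod_pi (fun i b => k i (z i) b * l i b (w i)), Finset.sum_mul]
  refine Finset.sum_congr rfl fun u _ => ?_
  rw [Finset.prod_mul_distrib]; ring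

lemma ev_op (ν : Fin n → A → ℝ) (k : Fin n → A → B → ℝ) (g : (Fin n → B) → ℝ) :
    ev ν (op k g) = ev (fun i b => ∑ a, ν i a * k i a b) g := by
  simp only [op, ev]
  simp_rw [Finset.mul_sum]
  rw [Finset.sum_comm]
  refine Finset.sum_congr rfl fun w _ => ?_
  rw [← sum_prod_pi (fun i a => ν i a * k i a (w i)), Finset.sum_mul]
  refine Finset.sum_congr rfl fun u _ => ?_
  rw [Finset.prod_mul_distrib]; ring

lemma ev_sq_op (ν : Fin n → A → ℝ) (k : Fin n → A → B → ℝ) (g : (Fin n → B) → ℝ) :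
    ev ν (fun z => (op k g z) ^ 2)
      = ∑ x, ∑ x', (∏ i, ∑ a, ν i a * k i a (x i) * k i a (x' i)) * (g x * g x') := by
  simp only [op, ev]
  simp_rw [sq, Finset.sum_mul_sum, Finset.mul_sum]
  rw [Finset.sum_comm]
  refine Finset.sum_congr rfl fun x _ => ?_
  rw [Finset.sum_comm]
  refine Finset.sum_congr rfl fun x' _ => ?_
  rw [← sum_prod_pi (fun i a => ν i a * k i a (x i) * k i a (x' i)), Finset.sum_mul]
  refine Finset.sum_congr rfl fun u _ => ?_
  rw [Finset.prod_mul_distrib, Finset.prod_mul_distrib]; ring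

lemma sum_cons (φ : (Fin (n+1) → A) → ℝ) :
    ∑ z, φ z = ∑ a, ∑ z : Fin n → A, φ (Fin.cons a z) := by
  rw [← (Fin.consEquiv (fun _ : Fin (n+1) => A)).sum_comp, Fintype.sum_prod_type]
  rfl

lemma ev_cons (ν : Fin (n+1) → A → ℝ) (g : (Fin (n+1) → A) → ℝ) :
    ev ν g = ∑ a, ν 0 a * ev (fun i => ν i.succ) (fun z => g (Fin.cons a z)) := by
  unfold ev
  rw [sum_cons]
  refine Finset.sum_congr rfl fun a _ => ?_
  rw [Finset.mul_sum]
  refine Finset.sum_congr rfl fun z _ => ?_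
  rw [Fin.prod_univ_succ]
  simp [mul_assoc]

lemma op_cons (k : Fin (n+1) → A → B → ℝ) (g : (Fin (n+1) → B) → ℝ) (a : A) (z : Fin n → A) :
    op k g (Fin.cons a z)
      = ∑ c, k 0 a c * op (fun i => k i.succ) (fun w => g (Fin.cons c w)) z := by
  unfold op
  rw [sum_cons]
  refine Finset.sum_congr rfl fun a _ => ?_
  rw [Finset.mul_sum]
  refine Finset.sum_congr rfl fun z _ => ?_
  rw [Fin.prod_univ_succ]
  simp [mul_assoc]

/-- Tensorization of quadratic form inequalities. -/
lemma tens : ∀ {n : ℕ} {A B C : Type} [Fintype A] [Fintype B] [Fintype C]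
    (lam : Fin n → A → ℝ) (kap : Fin n → B → ℝ) (k : Fin n → A → C → ℝ) (l : Fin n → B → C → ℝ),
    (∀ i a, 0 ≤ lam i a) → (∀ i a, 0 ≤ kap i a) →
    (∀ i (u : C → ℝ), ∑ a, lam i a * (∑ c, k i a c * u c) ^ 2
        ≤ ∑ b, kap i b * (∑ c, l i b c * u c) ^ 2) →
    ∀ h : (Fin n → C) → ℝ,
    ev lam (fun z => (op k h z) ^ 2) ≤ ev kap (fun z => (op l h z) ^ 2) := by
  intro n
  induction n with
  | zero =>
    intro A B C _ _ _ lam kap k l _ _ _ h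
    simp [ev, op]
  | succ n ih =>
    intro A B C _ _ _ lam kap k l h1 h2 H h
    rw [ev_cons, ev_cons]
    have e1 : ∀ a, ev (fun i => lam i.succ) (fun z => (op k h (Fin.cons a z)) ^ 2)
        ≤ ev (fun i => kap i.succ)
          (fun z => (∑ c, k 0 a c * op (fun i => l i.succ) (fun w => h (Fin.cons c w)) z) ^ 2) := by
      intro a
      have := ih (fun i => lam i.succ) (fun i => kap i.succ) (fun i => k i.succ)
        (fun i => l i.succ) (fun i => h1 _) (fun i => h2 _) (fun i => H _)
        (fun w => ∑ c, k 0 a c * h (Fin.cons c w))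
      simp only [op_sum, op_smul] at this
      simpa only [op_cons] using this
    calc _ ≤ ∑ a, lam 0 a * ev (fun i => kap i.succ)
          (fun z => (∑ c, k 0 a c * op (fun i => l i.succ) (fun w => h (Fin.cons c w)) z) ^ 2) :=
        Finset.sum_le_sum fun a _ => mul_le_mul_of_nonneg_left (e1 a) (h1 _ _)
      _ = ev (fun i => kap i.succ) (fun z => ∑ a, lam 0 a *
          (∑ c, k 0 a c * op (fun i => l i.succ) (fun w => h (Fin.cons c w)) z) ^ 2) := by
        rw [ev_sum]; simp only [ev_smul]
      _ ≤ ev (fun i => kap i.succ) (fun z => ∑ b, kap 0 b *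
          (∑ c, l 0 b c * op (fun i => l i.succ) (fun w => h (Fin.cons c w)) z) ^ 2) :=
        ev_mono (fun i => h2 _) fun z => H 0 _
      _ = _ := by
        rw [ev_sum]; simp only [ev_smul, op_cons]

end basics


/-! ### Averaging operators -/


section averaging

open Classical in
noncomputable def dl {A : Type} (a b : A) : ℝ := if a = b then 1 else 0

lemma dl_nonneg {A : Type} (a b : A) : 0 ≤ dl a b := by
  unfold dl; split_ifs <;> norm_num

lemma dl_comm {A : Type} (a b : A) : dl a b = dl b a := by
  by_cases h : a = b
  · subst h; rfl
  · simp [dl, h, Ne.symm h]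

lemma dl_self {A : Type} (a : A) : dl a a = 1 := by simp [dl]

lemma dl_ne {A : Type} {a b : A} (h : a ≠ b) : dl a b = 0 := by simp [dl, h]

variable {n : ℕ} {A B : Type} [Fintype A] [Fintype B]

lemma sum_dl_mul (a : A) (u : A → ℝ) : ∑ b, dl a b * u b = u a := by
  classical
  simp [dl]

lemma sum_mul_dl (b : A) (u : A → ℝ) : ∑ a, u a * dl a b = u b := by
  classical
  simp [dl]

lemma sum_mul_dl' (b : A) (u : A → ℝ) : ∑ a, u a * dl b a = u b := by
  classical
  simp [dl]

lemma sum_dl (a : A) : ∑ b, dl a b = 1 := by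
  simpa using sum_dl_mul a (fun _ => 1)

/-- product probability weights -/
def IsP (ν : Fin n → A → ℝ) : Prop := (∀ i a, 0 ≤ ν i a) ∧ ∀ i, ∑ a, ν i a = 1

/-- averaging kernel on the coordinates in `S` -/
noncomputable def avg (ν : Fin n → A → ℝ) (S : Fin n → Bool) (i : Fin n) (a b : A) : ℝ :=
  if S i then ν i b else dl a b

variable {ν : Fin n → A → ℝ}

lemma avg_nonneg (hν : IsP ν) (S : Fin n → Bool) (i : Fin n) (a b : A) : 0 ≤ avg ν S i a b := by
  unfold avg; split_ifs
  · exact hν.1 _ _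
  · exact dl_nonneg _ _

lemma avg_sum (hν : IsP ν) (S : Fin n → Bool) (i : Fin n) (a : A) : ∑ b, avg ν S i a b = 1 := by
  unfold avg; split_ifs
  · exact hν.2 _
  · exact sum_dl _

lemma op_dl (g : (Fin n → A) → ℝ) : op (fun _ a b => dl a b) g = g := by
  funext z
  have : ∀ w, (∏ i, dl (z i) (w i)) = dl z w := by
    intro w
    by_cases h : z = w
    · subst h; simp [dl_self]
    · rw [dl_ne h]
      obtain ⟨i, hi⟩ := Function.ne_iff.1 h
      exact Finset.prod_eq_zero (Finset.mem_univ i) (dl_ne hi)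
  simp only [op, this]
  exact sum_dl_mul z g

lemma op_avg_bot (g : (Fin n → A) → ℝ) : op (avg ν (fun _ => false)) g = g := by
  have : avg ν (fun _ => false) = fun _ a b => dl a b := by
    funext i a b; simp [avg]
  rw [this, op_dl]

lemma op_avg_top (g : (Fin n → A) → ℝ) (z : Fin n → A) :
    op (avg ν (fun _ => true)) g z = ev ν g := by
  simp [op, avg, ev]

lemma avg_avg (hν : IsP ν) (S T : Fin n → Bool) (g : (Fin n → A) → ℝ) :
    op (avg ν S) (op (avg ν T) g) = op (avg ν (S ⊔ T)) g := by
  funext z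
  rw [op_comp]
  congr 1
  funext i a c
  simp only [avg, Pi.sup_apply]
  by_cases hS : S i = true <;> by_cases hT : T i = true <;>
    simp [hS, hT, sum_dl_mul, sum_mul_dl, ← Finset.sum_mul, hν.2, sum_dl]

lemma ev_avg (hν : IsP ν) (S : Fin n → Bool) (g : (Fin n → A) → ℝ) :
    ev ν (op (avg ν S) g) = ev ν g := by
  rw [ev_op]
  congr 1
  funext i b
  simp only [avg]
  cases hS : S i <;> simp [sum_mul_dl, ← Finset.sum_mul, hν.2]

lemma ev_selfadj {k : Fin n → A → A → ℝ} (hk : ∀ i a b, ν i a * k i a b = ν i b * k i b a)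
    (g h : (Fin n → A) → ℝ) :
    ev ν (fun z => g z * op k h z) = ev ν (fun z => op k g z * h z) := by
  simp only [ev, op, Finset.mul_sum, Finset.sum_mul]
  rw [Finset.sum_comm]
  refine Finset.sum_congr rfl fun x _ => Finset.sum_congr rfl fun y _ => ?_
  have : (∏ i, ν i (y i)) * ∏ i, k i (y i) (x i) = (∏ i, ν i (x i)) * ∏ i, k i (x i) (y i) := by
    rw [← Finset.prod_mul_distrib, ← Finset.prod_mul_distrib]
    exact Finset.prod_congr rfl fun i _ => hk _ _ _
  calc _ = ((∏ i, ν i (y i)) * ∏ i, k i (y i) (x i)) * (g y * h x) := by ring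
    _ = _ := by rw [this]; ring

lemma avg_symm (S : Fin n → Bool) (i : Fin n) (a b : A) :
    ν i a * avg ν S i a b = ν i b * avg ν S i b a := by
  unfold avg
  split_ifs
  · ring
  · by_cases h : a = b
    · subst h; rfl
    · rw [dl_ne h, dl_ne (Ne.symm h)]; ring

noncomputable def aS (ν : Fin n → A → ℝ) (g : (Fin n → A) → ℝ) (S : Fin n → Bool) : ℝ :=
  ev ν (fun z => g z ^ 2) - ev ν (fun z => op (avg ν S) g z ^ 2)

lemma ev_avg_sq (hν : IsP ν) (S : Fin n → Bool) (g : (Fin n → A) → ℝ) :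
    ev ν (fun z => op (avg ν S) g z ^ 2) = ev ν (fun z => g z * op (avg ν S) g z) := by
  have := ev_selfadj (ν := ν) (avg_symm S) g (op (avg ν S) g)
  rw [avg_avg hν, sup_idem] at this
  rw [this]; simp only [sq]

lemma aS_eq_sq (hν : IsP ν) (S : Fin n → Bool) (g : (Fin n → A) → ℝ) :
    aS ν g S = ev ν (fun z => (g z - op (avg ν S) g z) ^ 2) := by
  have e : (fun z => (g z - op (avg ν S) g z) ^ 2) = fun z => g z ^ 2 - 2 * (g z * op (avg ν S) g z)
      + op (avg ν S) g z ^ 2 := by funext z; ring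
  rw [e, ev_add, ev_sub, ev_smul, aS, ev_avg_sq hν]; ring

lemma aS_nonneg (hν : IsP ν) (g : (Fin n → A) → ℝ) (S : Fin n → Bool) : 0 ≤ aS ν g S := by
  rw [aS_eq_sq hν]
  exact ev_nonneg hν.1 fun z => sq_nonneg _

lemma ev_avg_sq_le (hν : IsP ν) (S : Fin n → Bool) (g : (Fin n → A) → ℝ) :
    ev ν (fun z => op (avg ν S) g z ^ 2) ≤ ev ν (fun z => g z ^ 2) := by
  have := aS_nonneg hν g S
  unfold aS at this; linarith

lemma aS_mono (hν : IsP ν) (g : (Fin n → A) → ℝ) {S T : Fin n → Bool} (h : S ≤ T) :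
    aS ν g S ≤ aS ν g T := by
  have := ev_avg_sq_le hν T (op (avg ν S) g)
  rw [avg_avg hν, sup_eq_left.2 h] at this
  unfold aS; linarith

lemma aS_bot (g : (Fin n → A) → ℝ) : aS ν g (fun _ => false) = 0 := by
  unfold aS; rw [op_avg_bot]; ring

lemma aS_top (hν : IsP ν) (g : (Fin n → A) → ℝ) :
    aS ν g (fun _ => true) = ev ν (fun z => g z ^ 2) - (ev ν g) ^ 2 := by
  unfold aS; simp only [op_avg_top]; rw [ev_const hν.2]

lemma aS_sup_eq (hν : IsP ν) (g : (Fin n → A) → ℝ) (S T : Fin n → Bool) :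
    aS ν g (S ⊔ T) = aS ν g T + aS ν (op (avg ν T) g) S := by
  unfold aS; rw [avg_avg hν]; ring

lemma aS_avg_eq (hν : IsP ν) (g : (Fin n → A) → ℝ) (S T : Fin n → Bool) :
    aS ν (op (avg ν T) g) S
      = ev ν (fun z => op (avg ν T) (fun w => g w - op (avg ν S) g w) z ^ 2) := by
  rw [aS_eq_sq hν]
  congr 1; funext z
  rw [op_sub, avg_avg hν, avg_avg hν, sup_comm]

lemma aS_sup (hν : IsP ν) (g : (Fin n → A) → ℝ) (S T : Fin n → Bool) :
    aS ν g (S ⊔ T) ≤ aS ν g S + aS ν g T := by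
  rw [aS_sup_eq hν, aS_avg_eq hν, aS_eq_sq hν S]
  have := ev_avg_sq_le hν T (fun w => g w - op (avg ν S) g w)
  linarith

lemma aS_bool (hν : IsP ν) {h : (Fin n → A) → ℝ} (hb : ∀ z, h z = 0 ∨ h z = 1)
    (S : Fin n → Bool) :
    ev ν (fun z => |h z - op (avg ν S) h z|) = 2 * aS ν h S := by
  have hm : ∀ z, h z ∈ Set.Icc (0:ℝ) 1 := fun z => by rcases hb z with e | e <;> rw [e] <;> simp
  have e : (fun z => |h z - op (avg ν S) h z|)
      = fun z => (h z + op (avg ν S) h z) - 2 * (h z * op (avg ν S) h z) := by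
    funext z
    have := op_mem (avg_nonneg hν S) (avg_sum hν S) hm z
    rcases hb z with e | e <;> rw [e]
    · rw [zero_sub, abs_neg, abs_of_nonneg this.1]; ring
    · rw [abs_of_nonneg (by linarith [this.2])]; ring
  have e2 : (fun z => h z ^ 2) = h := by
    funext z; rcases hb z with e | e <;> rw [e] <;> norm_num
  rw [e, ev_sub, ev_add, ev_smul, ev_avg hν, aS, ev_avg_sq hν, e2]; ring

/-- Intertwining. -/
lemma intertwine {π : Fin n → B → ℝ} (T : Fin n → B → A → ℝ) (hT : ∀ i b, ∑ a, T i b a = 1)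
    (hν : ∀ i a, ∑ b, π i b * T i b a = ν i a) (S : Fin n → Bool) (g : (Fin n → A) → ℝ) :
    op T (op (avg ν S) g) = op (avg π S) (op T g) := by
  funext z
  rw [op_comp, op_comp]
  congr 1
  funext i a c
  simp only [avg]
  cases hS : S i
  · simp [sum_mul_dl, sum_dl_mul]
  · simp [← Finset.sum_mul, hT, hν]

end averaging


/-! ### Random colorings -/

section colorings

variable {n m : ℕ} {A B : Type} [Fintype A] [Fintype B]

lemma ev_prod_type (ν : Fin n → A → ℝ) (κ : Fin n → B → ℝ) (G : (Fin n → A × B) → ℝ) :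
    ev (fun i p => ν i p.1 * κ i p.2) G
      = ev κ (fun c => ev ν (fun z => G (fun i => (z i, c i)))) := by
  unfold ev
  rw [← (Equiv.arrowProdEquivProdArrow (Fin n) (fun _ => A) (fun _ => B)).symm.sum_comp]
  rw [Fintype.sum_prod_type, Finset.sum_comm]
  refine Finset.sum_congr rfl fun c _ => ?_
  rw [Finset.mul_sum]
  refine Finset.sum_congr rfl fun z _ => ?_
  simp only [Equiv.arrowProdEquivProdArrow, Equiv.coe_fn_symm_mk, Finset.prod_mul_distrib]
  ring

/-- average over uniformly random colorings -/
noncomputable def Ec (φ : (Fin n → Fin m) → ℝ) : ℝ :=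
  ev (fun _ _ => ((m : ℝ))⁻¹) φ

lemma isP_col (hm : 0 < m) : IsP (fun (_ : Fin n) (_ : Fin m) => ((m : ℝ))⁻¹) := by
  constructor
  · intro i a; positivity
  · intro i
    have : (m : ℝ) ≠ 0 := by positivity
    simp [this]

lemma Ec_mono (φ ψ : (Fin n → Fin m) → ℝ) (h : ∀ c, φ c ≤ ψ c) : Ec φ ≤ Ec ψ :=
  ev_mono (fun _ _ => by positivity) h

lemma Ec_const (hm : 0 < m) (x : ℝ) : Ec (fun _ : Fin n → Fin m => x) = x :=
  ev_const (isP_col hm).2 x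

/-- The set of coordinates in `J` whose color is in `s`. -/
def col (J : Fin n → Bool) (s : Finset (Fin m)) (c : Fin n → Fin m) : Fin n → Bool :=
  fun i => J i && decide (c i ∈ s)

lemma Ec_sym (φ : (Fin n → Bool) → ℝ) (J : Fin n → Bool) (b b' : Fin m) :
    Ec (fun c => φ (col J {b} c)) = Ec (fun c => φ (col J {b'} c)) := by
  unfold Ec ev
  rw [← (Equiv.arrowCongr (Equiv.refl (Fin n)) (Equiv.swap b b')).sum_comp]
  refine Finset.sum_congr rfl fun c _ => ?_
  congr 1
  beta_reduce
  congr 1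
  funext i
  simp only [col, Finset.mem_singleton, Equiv.arrowCongr_apply, Equiv.refl_symm, Equiv.coe_refl,
    Function.comp_def, id]
  have : (Equiv.swap b b' (c i) = b) = (c i = b') := by
    rw [Equiv.swap_apply_eq_iff, Equiv.swap_apply_left]
  simp only [this]

lemma col_sub {a : (Fin n → Bool) → ℝ} (h0 : a (fun _ => false) = 0)
    (hs : ∀ S T, a (S ⊔ T) ≤ a S + a T) (J : Fin n → Bool) (c : Fin n → Fin m)
    (s : Finset (Fin m)) : a (col J s c) ≤ ∑ b ∈ s, a (col J {b} c) := by
  classical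
  induction s using Finset.induction_on with
  | empty =>
    have : col J (∅ : Finset (Fin m)) c = fun _ => false := by funext i; simp [col]
    simp [this, h0]
  | insert x s hx ih =>
    rw [Finset.sum_insert hx]
    have : col J (insert x s) c = col J {x} c ⊔ col J s c := by
      funext i
      simp only [col, Pi.sup_apply, Finset.mem_insert, Finset.mem_singleton]
      by_cases h1 : J i = true <;> by_cases h2 : c i = x <;> by_cases h3 : c i ∈ s <;>
        simp [h1, h2, h3]
    rw [this]
    linarith [hs (col J {x} c) (col J s c)]

lemma Ec_col_le {a : (Fin n → Bool) → ℝ} (h0 : a (fun _ => false) = 0)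
    (hs : ∀ S T, a (S ⊔ T) ≤ a S + a T) (J : Fin n → Bool) (s : Finset (Fin m)) (b : Fin m) :
    Ec (fun c => a (col J s c)) ≤ s.card * Ec (fun c => a (col J {b} c)) := by
  calc _ ≤ Ec (fun c => ∑ b ∈ s, a (col J {b} c)) := Ec_mono _ _ fun c => col_sub h0 hs J c s
    _ = ∑ b ∈ s, Ec (fun c => a (col J {b} c)) := by unfold Ec; rw [ev_sum]
    _ = ∑ _ ∈ s, Ec (fun c => a (col J {b} c)) :=
      Finset.sum_congr rfl fun b' _ => Ec_sym a J b' b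
    _ = _ := by simp

lemma Ec_col_ge {a : (Fin n → Bool) → ℝ} (h0 : a (fun _ => false) = 0)
    (hs : ∀ S T, a (S ⊔ T) ≤ a S + a T) (J : Fin n → Bool) (b : Fin m) :
    a J / m ≤ Ec (fun c => a (col J {b} c)) := by
  have hm : 0 < m := b.pos
  have := Ec_col_le h0 hs J Finset.univ b
  have e : ∀ c : Fin n → Fin m, col J Finset.univ c = J := by intro c; funext i; simp [col]
  simp only [e, Finset.card_univ, Fintype.card_fin] at this
  rw [Ec_const hm] at this
  rw [div_le_iff₀ (by positivity)]
  linarith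

lemma cons_sup (x y : Bool) (S T : Fin n → Bool) :
    (Fin.cons x S : Fin (n+1) → Bool) ⊔ Fin.cons y T = Fin.cons (x ⊔ y) (S ⊔ T) := by
  funext i
  refine Fin.cases ?_ (fun i => ?_) i <;> simp

lemma cons_le {x y : Bool} {S T : Fin n → Bool} (h : x ≤ y) (h2 : S ≤ T) :
    (Fin.cons x S : Fin (n+1) → Bool) ≤ Fin.cons y T := by
  intro i
  refine Fin.cases ?_ (fun i => ?_) i
  · simpa using h
  · simpa using h2 i

lemma Ec_cons (φ : (Fin (n+1) → Fin m) → ℝ) :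
    Ec φ = ∑ x, (m : ℝ)⁻¹ * Ec (fun c => φ (Fin.cons x c)) := by
  unfold Ec; rw [ev_cons]

/-- colour-class indicator -/
def cl (b : Fin m) (c : Fin n → Fin m) : Fin n → Bool := fun i => decide (c i = b)

lemma cl_cons (b x : Fin m) (c : Fin n → Fin m) :
    cl b (Fin.cons x c : Fin (n+1) → Fin m) = Fin.cons (decide (x = b)) (cl b c) := by
  funext i
  refine Fin.cases ?_ (fun i => ?_) i <;> simp [cl]

def sgl (i : Fin n) : Fin n → Bool := fun k => decide (k = i)

lemma second_moment (b0 : Fin m) (τ : ℝ) (hτ : 0 ≤ τ) : ∀ {n : ℕ} (a b : (Fin n → Bool) → ℝ),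
    (∀ S T, S ≤ T → a S ≤ a T) → (∀ S T, a (S ⊔ T) ≤ a S + b T) →
    (∀ S T, S ≤ T → b S ≤ b T) → (∀ i, b (sgl i) ≤ τ) → (∀ S, 0 ≤ b S) →
    Ec (fun c => (a (cl b0 c) - a (fun _ => false)) ^ 2)
      ≤ 2 * Ec (fun c => a (cl b0 c) - a (fun _ => false)) * (τ + Ec (fun c => b (cl b0 c))) := by
  have hm : 0 < m := b0.pos
  have hm' : (m : ℝ) ≠ 0 := by positivity
  intro n
  induction n with
  | zero =>
    intro a b h1 h2 h3 h4 h5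
    have : ∀ c : Fin 0 → Fin m, cl b0 c = fun _ => false := fun c => Subsingleton.elim _ _
    simp only [this, sub_self]
    rw [Ec_const hm, Ec_const hm]; norm_num
  | succ n ih =>
    intro a b h1 h2 h3 h4 h5
    have hbot : (Fin.cons false (fun _ => false) : Fin (n+1) → Bool) = fun _ => false := by
      funext i; refine Fin.cases ?_ (fun i => ?_) i <;> simp
    set V := Ec (fun c => b (cl b0 c)) with hV
    set V' := Ec (fun c : Fin n → Fin m => b (Fin.cons false (cl b0 c))) with hV'
    have hVV : V' ≤ V := by
      rw [hV, Ec_cons]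
      calc V' = ∑ x : Fin m, (m : ℝ)⁻¹ * V' := by simp [hm']
        _ ≤ _ := by
          refine Finset.sum_le_sum fun x _ => mul_le_mul_of_nonneg_left ?_ (by positivity)
          refine Ec_mono _ _ fun c => ?_
          rw [cl_cons]
          exact h3 _ _ (cons_le (Bool.false_le _) le_rfl)
    have key : ∀ x : Fin m,
        Ec (fun c => (a (Fin.cons (decide (x = b0)) (cl b0 c)) - a (fun _ => false)) ^ 2)
        ≤ 2 * (τ + V) *
          Ec (fun c => a (Fin.cons (decide (x = b0)) (cl b0 c)) - a (fun _ => false)) := by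
      intro x
      set y := decide (x = b0) with hy
      set d := a (Fin.cons y (fun _ => false)) - a (fun _ => false) with hd
      have hd0 : 0 ≤ d := by
        have := h1 _ _ (show (fun _ => false) ≤ (Fin.cons y (fun _ => false) : Fin (n+1) → Bool)
          from fun _ => Bool.false_le _)
        rw [hd]; linarith
      have hdτ : d ≤ τ := by
        have e1 := h1 (Fin.cons y (fun _ => false)) ((fun _ => false) ⊔ sgl 0) (by
          intro i
          refine Fin.cases ?_ (fun i => ?_) i
          · simp [sgl, Bool.le_true]
          · simp)
        have e2 := h2 (fun _ => false) (sgl 0)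
        have e3 := h4 0
        rw [hd]; linarith
      have I := ih (fun S => a (Fin.cons y S)) (fun S => b (Fin.cons false S))
        (fun S T h => h1 _ _ (cons_le le_rfl h))
        (fun S T => by
          have := h2 (Fin.cons y S) (Fin.cons false T)
          rw [cons_sup] at this
          simpa using this)
        (fun S T h => h3 _ _ (cons_le le_rfl h))
        (fun i => by
          have : (Fin.cons false (sgl i) : Fin (n+1) → Bool) = sgl i.succ := by
            funext k; refine Fin.cases ?_ (fun k => ?_) k
            · simp only [Fin.cons_zero, sgl]
              exact (decide_eq_false (Fin.succ_ne_zero i).symm).symm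
            · simp [sgl]
          rw [this]; exact h4 _)
        (fun S => h5 _)
      set X := fun c : Fin n → Fin m => a (Fin.cons y (cl b0 c)) - a (Fin.cons y (fun _ => false))
        with hX
      have hXV : Ec X ≤ V' := Ec_mono _ _ fun c => by
        have := h2 (Fin.cons y (fun _ => false)) (Fin.cons false (cl b0 c))
        rw [cons_sup] at this
        have e : (fun _ => false) ⊔ cl b0 c = cl b0 c := by funext i; simp
        rw [e] at this
        simp only [hX]
        simp at this; linarith
      have hX0 : 0 ≤ Ec X := by
        have := Ec_mono (fun _ => 0) X fun c => by
          have := h1 _ _ (cons_le (le_refl y) (show (fun _ => false) ≤ cl b0 c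
            from fun _ => Bool.false_le _))
          simp only [hX]; linarith
        rwa [Ec_const hm] at this
      have e1 : Ec (fun c => (a (Fin.cons y (cl b0 c)) - a (fun _ => false)) ^ 2)
          = Ec (fun c => X c ^ 2) + 2 * d * Ec X + d ^ 2 := by
        have : (fun c : Fin n → Fin m => (a (Fin.cons y (cl b0 c)) - a (fun _ => false)) ^ 2)
          = fun c => (X c ^ 2 + 2 * d * X c) + d ^ 2 := by
          funext c; simp only [hX, hd]; ring
        rw [this]
        have h3 := Ec_const (n := n) hm (d ^ 2)
        unfold Ec at h3 ⊢
        rw [ev_add, ev_add, ev_smul, h3]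
      have e2 : Ec (fun c => (a (Fin.cons y (cl b0 c)) - a (fun _ => false)))
          = Ec X + d := by
        have : (fun c : Fin n → Fin m => (a (Fin.cons y (cl b0 c)) - a (fun _ => false)))
          = fun c => X c + d := by
          funext c; simp only [hX, hd]; ring
        rw [this]
        have h3 := Ec_const (n := n) hm d
        unfold Ec at h3 ⊢
        rw [ev_add, h3]
      rw [e1, e2]
      have I' : Ec (fun c => X c ^ 2) ≤ 2 * Ec X * (τ + V') := I
      nlinarith [mul_nonneg hd0 (sub_nonneg.2 hdτ), mul_nonneg hd0 (sub_nonneg.2 hXV),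
        mul_nonneg (add_nonneg hX0 hd0) (sub_nonneg.2 hVV), mul_nonneg hd0 hτ]
    rw [Ec_cons, Ec_cons (fun c => a (cl b0 c) - a (fun _ => false))]
    simp only [cl_cons]
    calc _ ≤ ∑ x, (m : ℝ)⁻¹ * (2 * (τ + V) *
          Ec (fun c => a (Fin.cons (decide (x = b0)) (cl b0 c)) - a (fun _ => false))) :=
        Finset.sum_le_sum fun x _ => mul_le_mul_of_nonneg_left (key x) (by positivity)
      _ = _ := by
        rw [Finset.mul_sum, Finset.sum_mul]
        exact Finset.sum_congr rfl fun x _ => by ring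

lemma cl_eq_col (b : Fin m) (c : Fin n → Fin m) : col (fun _ => true) {b} c = cl b c := by
  funext i; simp [col, cl]

end colorings


/-! ### Hypercontractivity -/

section hyper

lemma hyper_pt {s α e y : ℝ} (hα : 0 < α) (hs0 : 0 ≤ s) (hs1 : s < 1) (he : e * (1 + α) = s * α)
    (he0 : 0 ≤ e) (he1 : e < 1) (hy0 : 0 ≤ y) (hy : y * α ≤ 1) :
    1 + (2 - e) * (y - 1) + (1 - s) * (y - 1) ^ 2 ≤ y ^ (2 - e) := by
  rcases hy0.eq_or_lt with h | h
  · subst h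
    rw [Real.zero_rpow (by linarith)]
    nlinarith
  · have h1 : y ^ (2 - e) = y ^ 2 * Real.exp (-(e * Real.log y)) := by
      rw [show (2 - e : ℝ) = 2 + (-e) by ring, Real.rpow_add h, Real.rpow_two,
        Real.rpow_def_of_pos h (-e)]
      congr 2; ring
    have h2 := Real.add_one_le_exp (-(e * Real.log y))
    have h3 := Real.log_le_sub_one_of_pos h
    have h4 : y ^ 2 * (1 - e * (y - 1)) ≤ y ^ (2 - e) := by
      rw [h1]
      refine mul_le_mul_of_nonneg_left ?_ (by positivity)
      nlinarith [mul_le_mul_of_nonneg_left h3 he0]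
    have h5 : e * (1 + y) ≤ s := by
      have : e * (1 + y) * α ≤ s * α := by nlinarith
      exact le_of_mul_le_mul_right this hα
    nlinarith [mul_le_mul_of_nonneg_right h5 (sq_nonneg (y - 1))]

variable {X : Type} [Fintype X]

lemma hyper_base {s α e : ℝ} (hα : 0 < α) (hs0 : 0 ≤ s) (hs1 : s < 1)
    (he : e * (1 + α) = s * α)
    (he0 : 0 ≤ e) (he1 : e < 1) (π : X → ℝ) (hπ : ∀ x, α ≤ π x) (hπ1 : ∑ x, π x = 1)
    (U : X → ℝ) (hU : ∀ x, 0 ≤ U x) :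
    (1 - s) * ∑ x, π x * U x ^ 2 + s * (∑ x, π x * U x) ^ 2
      ≤ (∑ x, π x * U x ^ (2 - e)) ^ (2 / (2 - e)) := by
  have hp : 0 < 2 - e := by linarith
  have hπ0 : ∀ x, 0 < π x := fun x => lt_of_lt_of_le hα (hπ x)
  set M := ∑ x, π x * U x with hM
  have hM0 : 0 ≤ M := Finset.sum_nonneg fun x _ => mul_nonneg (hπ0 x).le (hU x)
  rcases hM0.eq_or_lt with h | h
  · have hz : ∀ x, U x = 0 := by
      intro x
      have := (Finset.sum_eq_zero_iff_of_nonneg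
        (fun x _ => mul_nonneg (hπ0 x).le (hU x))).1 (hM.symm.trans h.symm) x (Finset.mem_univ _)
      exact (mul_eq_zero.1 this).resolve_left (hπ0 x).ne'
    rw [← h]
    have hz2 : ∑ x, π x * U x ^ 2 = 0 := Finset.sum_eq_zero fun x _ => by rw [hz]; ring
    rw [hz2]
    norm_num
    exact Real.rpow_nonneg (Finset.sum_nonneg fun x _ =>
      mul_nonneg (hπ0 x).le (Real.rpow_nonneg (hU x) _)) _
  · have hle : ∀ x, U x / M * α ≤ 1 := by
      intro x
      rw [div_mul_eq_mul_div, div_le_one h]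
      calc U x * α ≤ π x * U x := by rw [mul_comm]; exact mul_le_mul_of_nonneg_right (hπ x) (hU x)
        _ ≤ M := Finset.single_le_sum (f := fun x => π x * U x)
          (fun x _ => mul_nonneg (hπ0 x).le (hU x)) (Finset.mem_univ x)
    have key := fun x => hyper_pt hα hs0 hs1 he he0 he1 (div_nonneg (hU x) hM0) (hle x)
    have e1 : ∀ x, (U x / M) ^ (2 - e) = U x ^ (2 - e) / M ^ (2 - e) :=
      fun x => Real.div_rpow (hU x) hM0 _
    set Z := ∑ x, π x * U x ^ (2 - e) with hZ
    have hMp : 0 < M ^ (2 - e) := Real.rpow_pos_of_pos h _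
    have sumkey : 1 + (1 - s) * ((∑ x, π x * U x ^ 2) / M ^ 2 - 1) ≤ Z / M ^ (2 - e) := by
      have : ∑ x, π x * (1 + (2 - e) * (U x / M - 1) + (1 - s) * (U x / M - 1) ^ 2)
          ≤ ∑ x, π x * (U x ^ (2 - e) / M ^ (2 - e)) :=
        Finset.sum_le_sum fun x _ => mul_le_mul_of_nonneg_left (by rw [← e1]; exact key x)
          (hπ0 x).le
      have r : ∑ x, π x * (U x ^ (2 - e) / M ^ (2 - e)) = Z / M ^ (2 - e) := by
        rw [hZ, Finset.sum_div]; exact Finset.sum_congr rfl fun x _ => by ring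
      have l : ∑ x, π x * (1 + (2 - e) * (U x / M - 1) + (1 - s) * (U x / M - 1) ^ 2)
          = (1 - (2 - e) + (1 - s)) * ∑ x, π x + ((2 - e) / M - 2 * (1 - s) / M) * ∑ x, π x * U x
            + (1 - s) / M ^ 2 * ∑ x, π x * U x ^ 2 := by
        rw [Finset.mul_sum, Finset.mul_sum, Finset.mul_sum, ← Finset.sum_add_distrib,
          ← Finset.sum_add_distrib]
        refine Finset.sum_congr rfl fun x _ => ?_
        field_simp; ring
      rw [r, l, hπ1, ← hM] at this
      refine le_trans (le_of_eq ?_) this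
      field_simp; ring
    clear_value M
    have hvar : M ^ 2 ≤ ∑ x, π x * U x ^ 2 := by
      have h0 : 0 ≤ ∑ x, π x * (U x - M) ^ 2 :=
        Finset.sum_nonneg fun x _ => mul_nonneg (hπ0 x).le (sq_nonneg _)
      have : ∑ x, π x * (U x - M) ^ 2
          = ∑ x, π x * U x ^ 2 - 2 * M * ∑ x, π x * U x + M ^ 2 * ∑ x, π x := by
        rw [Finset.mul_sum Finset.univ _ (2 * M), Finset.mul_sum, ← Finset.sum_sub_distrib,
          ← Finset.sum_add_distrib]
        exact Finset.sum_congr rfl fun x _ => by ring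
      rw [this, hπ1, ← hM] at h0
      nlinarith
    have h1 : 1 ≤ Z / M ^ (2 - e) := by
      refine le_trans ?_ sumkey
      have : 1 ≤ (∑ x, π x * U x ^ 2) / M ^ 2 := by rw [le_div_iff₀ (by positivity)]; linarith
      nlinarith
    have h2 : Z / M ^ (2 - e) ≤ (Z / M ^ (2 - e)) ^ (2 / (2 - e)) := by
      apply Real.self_le_rpow_of_one_le h1
      rw [le_div_iff₀ hp]; linarith
    have hZ0 : 0 ≤ Z := Finset.sum_nonneg fun x _ =>
      mul_nonneg (hπ0 x).le (Real.rpow_nonneg (hU x) _)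
    have h3 : (Z / M ^ (2 - e)) ^ (2 / (2 - e)) = Z ^ (2 / (2 - e)) / M ^ 2 := by
      rw [Real.div_rpow hZ0 hMp.le, ← Real.rpow_mul hM0, mul_div_cancel₀ _ hp.ne', Real.rpow_two]
    have h4 : 1 + (1 - s) * ((∑ x, π x * U x ^ 2) / M ^ 2 - 1) ≤ Z ^ (2 / (2 - e)) / M ^ 2 := by
      rw [← h3]; exact sumkey.trans h2
    rw [le_div_iff₀ (by positivity)] at h4
    refine le_trans (le_of_eq ?_) h4
    field_simp; ring

/-- the noise form -/
noncomputable def Mk (s : ℝ) (π : X → ℝ) (b b' : X) : ℝ :=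
  (1 - s) * (π b * dl b b') + s * (π b * π b')

lemma Mk_bil (s : ℝ) (π : X → ℝ) (U V : X → ℝ) :
    ∑ b, ∑ b', Mk s π b b' * (U b * V b')
      = (1 - s) * ∑ x, π x * (U x * V x) + s * ((∑ x, π x * U x) * ∑ x, π x * V x) := by
  rw [Finset.sum_mul_sum, Finset.mul_sum, Finset.mul_sum, ← Finset.sum_add_distrib]
  refine Finset.sum_congr rfl fun b _ => ?_
  have : ∀ b', Mk s π b b' * (U b * V b')
      = dl b b' * ((1 - s) * π b * U b * V b') + s * ((π b * U b) * (π b' * V b')) := by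
    intro b'; unfold Mk; ring
  simp only [this]
  rw [Finset.sum_add_distrib, sum_dl_mul, Finset.mul_sum]
  ring

lemma hyper_bil {s α e : ℝ} (hα : 0 < α) (hs0 : 0 ≤ s) (hs1 : s < 1) (he : e * (1 + α) = s * α)
    (he0 : 0 ≤ e) (he1 : e < 1) (π : X → ℝ) (hπ : ∀ x, α ≤ π x) (hπ1 : ∑ x, π x = 1)
    (U V : X → ℝ) (hU : ∀ x, 0 ≤ U x) (hV : ∀ x, 0 ≤ V x) :
    ∑ b, ∑ b', Mk s π b b' * (U b * V b')
      ≤ (∑ x, π x * U x ^ (2 - e)) ^ (1 / (2 - e)) * (∑ x, π x * V x ^ (2 - e)) ^ (1 / (2 - e)) := by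
  have hπ0 : ∀ x, 0 ≤ π x := fun x => hα.le.trans (hπ x)
  rw [Mk_bil]
  set Bl := (1 - s) * ∑ x, π x * (U x * V x) + s * ((∑ x, π x * U x) * ∑ x, π x * V x) with hB
  set FU := (1 - s) * ∑ x, π x * U x ^ 2 + s * (∑ x, π x * U x) ^ 2 with hFU
  set FV := (1 - s) * ∑ x, π x * V x ^ 2 + s * (∑ x, π x * V x) ^ 2 with hFV
  have hCS : Bl ^ 2 ≤ FU * FV := by
    have := discrim_le_zero (a := FU) (b := 2 * Bl) (c := FV) (by
      intro t
      have h0 : 0 ≤ (1 - s) * ∑ x, π x * (t * U x + V x) ^ 2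
          + s * (∑ x, π x * (t * U x + V x)) ^ 2 := by
        have : 0 ≤ ∑ x, π x * (t * U x + V x) ^ 2 :=
          Finset.sum_nonneg fun x _ => mul_nonneg (hπ0 x) (sq_nonneg _)
        have h2 : 0 ≤ 1 - s := by linarith
        positivity
      have e1 : ∑ x, π x * (t * U x + V x) ^ 2 = t ^ 2 * ∑ x, π x * U x ^ 2
          + 2 * t * ∑ x, π x * (U x * V x) + ∑ x, π x * V x ^ 2 := by
        rw [Finset.mul_sum, Finset.mul_sum, ← Finset.sum_add_distrib, ← Finset.sum_add_distrib]
        exact Finset.sum_congr rfl fun x _ => by ring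
      have e2 : ∑ x, π x * (t * U x + V x) = t * ∑ x, π x * U x + ∑ x, π x * V x := by
        rw [Finset.mul_sum, ← Finset.sum_add_distrib]
        exact Finset.sum_congr rfl fun x _ => by ring
      rw [e1, e2] at h0
      rw [hFU, hFV, hB]
      linarith)
    unfold discrim at this; nlinarith
  have bU := hyper_base hα hs0 hs1 he he0 he1 π hπ hπ1 U hU
  have bV := hyper_base hα hs0 hs1 he he0 he1 π hπ hπ1 V hV
  have nn : ∀ W : X → ℝ, (∀ x, 0 ≤ W x) → 0 ≤ ∑ x, π x * W x ^ (2 - e) := fun W hW =>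
    Finset.sum_nonneg fun x _ => mul_nonneg (hπ0 x) (Real.rpow_nonneg (hW x) _)
  have sqr : ∀ Z : ℝ, 0 ≤ Z → Z ^ (2 / (2 - e)) = (Z ^ (1 / (2 - e))) ^ 2 := by
    intro Z hZ
    rw [← Real.rpow_two, ← Real.rpow_mul hZ]
    congr 1; ring
  rw [sqr _ (nn U hU)] at bU
  rw [sqr _ (nn V hV)] at bV
  have hV0 : 0 ≤ FV := by
    have : 0 ≤ ∑ x, π x * V x ^ 2 :=
      Finset.sum_nonneg fun x _ => mul_nonneg (hπ0 x) (sq_nonneg _)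
    have h2 : 0 ≤ 1 - s := by linarith
    positivity
  refine le_trans (le_abs_self _) (abs_le_of_sq_le_sq ?_ (mul_nonneg
    (Real.rpow_nonneg (nn U hU) _) (Real.rpow_nonneg (nn V hV) _)))
  rw [mul_pow]
  exact hCS.trans (mul_le_mul bU bV hV0 (sq_nonneg _))

lemma hyper_tens {s α e : ℝ} (hα : 0 < α) (hs0 : 0 ≤ s) (hs1 : s < 1) (he : e * (1 + α) = s * α)
    (he0 : 0 ≤ e) (he1 : e < 1) : ∀ {n : ℕ} (π : Fin n → X → ℝ) (_ : ∀ i x, α ≤ π i x)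
    (_ : ∀ i, ∑ x, π i x = 1) (u v : (Fin n → X) → ℝ) (_ : ∀ x, 0 ≤ u x) (_ : ∀ x, 0 ≤ v x),
    ∑ x, ∑ x', (∏ i, Mk s (π i) (x i) (x' i)) * (u x * v x')
      ≤ (ev π (fun z => u z ^ (2 - e))) ^ (1 / (2 - e))
        * (ev π (fun z => v z ^ (2 - e))) ^ (1 / (2 - e)) := by
  have hp : (2 - e) ≠ 0 := by linarith
  intro n
  induction n with
  | zero =>
    intro π _ _ u v hu hv
    simp only [ev, Finset.univ_unique, Finset.sum_singleton, Finset.univ_eq_empty,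
      Finset.prod_empty, one_mul]
    rw [← Real.rpow_mul (hu _), ← Real.rpow_mul (hv _), mul_one_div_cancel hp, Real.rpow_one,
      Real.rpow_one]
  | succ n ih =>
    intro π hπ hπ1 u v hu hv
    have hπ0 : ∀ i x, 0 ≤ π i x := fun i x => hα.le.trans (hπ i x)
    have nn : ∀ w : (Fin n → X) → ℝ, (∀ x, 0 ≤ w x) →
        0 ≤ ev (fun i => π i.succ) (fun z => w z ^ (2 - e)) := fun w hw =>
      ev_nonneg (fun i => hπ0 _) fun z => Real.rpow_nonneg (hw z) _
    have step : ∀ a a', ∑ x, ∑ x', (∏ i : Fin n, Mk s (π i.succ) (x i) (x' i))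
        * (u (Fin.cons a x) * v (Fin.cons a' x')) ≤ _ := fun a a' =>
      ih (fun i => π i.succ) (fun i => hπ _) (fun i => hπ1 _) (fun x => u (Fin.cons a x))
        (fun x => v (Fin.cons a' x)) (fun x => hu _) (fun x => hv _)
    have e1 : ∑ x, ∑ x', (∏ i, Mk s (π i) (x i) (x' i)) * (u x * v x')
        = ∑ a, ∑ a', Mk s (π 0) a a' * ∑ x, ∑ x', (∏ i : Fin n, Mk s (π i.succ) (x i) (x' i))
        * (u (Fin.cons a x) * v (Fin.cons a' x')) := by
      rw [sum_cons]
      refine Finset.sum_congr rfl fun a _ => ?_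
      simp only [sum_cons (n := n), Finset.mul_sum]
      rw [Finset.sum_comm]
      refine Finset.sum_congr rfl fun a' _ => Finset.sum_congr rfl fun x _ =>
        Finset.sum_congr rfl fun x' _ => ?_
      rw [Fin.prod_univ_succ]
      simp [mul_assoc]
    rw [e1]
    have hM : ∀ a a', 0 ≤ Mk s (π 0) a a' := by
      intro a a'
      have h1 := hπ0 0 a
      have h2 := hπ0 0 a'
      have h3 := dl_nonneg a a'
      have h4 : 0 ≤ 1 - s := by linarith
      unfold Mk; positivity
    refine le_trans (Finset.sum_le_sum fun a _ => Finset.sum_le_sum fun a' _ =>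
      mul_le_mul_of_nonneg_left (step a a') (hM a a')) ?_
    refine le_trans (hyper_bil hα hs0 hs1 he he0 he1 (π 0) (hπ 0) (hπ1 0)
      (fun a => (ev (fun i => π i.succ) (fun z => u (Fin.cons a z) ^ (2 - e))) ^ (1 / (2 - e)))
      (fun a => (ev (fun i => π i.succ) (fun z => v (Fin.cons a z) ^ (2 - e))) ^ (1 / (2 - e)))
      (fun a => Real.rpow_nonneg (nn _ fun x => hu _) _)
      (fun a => Real.rpow_nonneg (nn _ fun x => hv _) _)) (le_of_eq ?_)
    have r : ∀ w : (Fin (n+1) → X) → ℝ, (∀ x, 0 ≤ w x) → ∀ a,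
      ((ev (fun i => π i.succ) (fun z => w (Fin.cons a z) ^ (2 - e))) ^ (1 / (2 - e))) ^ (2 - e)
        = ev (fun i => π i.succ) (fun z => w (Fin.cons a z) ^ (2 - e)) := by
      intro w hw a
      rw [← Real.rpow_mul (nn _ fun x => hw _), one_div_mul_cancel hp, Real.rpow_one]
    simp only [r u hu, r v hv]
    rw [ev_cons, ev_cons]

/-- Hypercontractivity for random averaging. -/
lemma hyper {α e : ℝ} {n m : ℕ} (hα : 0 < α) (sC : Finset (Fin m)) (hs1 : (sC.card : ℝ) / m < 1)
    (hm : 0 < m)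
    (he : e * (1 + α) = (sC.card : ℝ) / m * α)
    (he0 : 0 ≤ e) (he1 : e < 1) (π : Fin n → X → ℝ) (hπ : ∀ i x, α ≤ π i x)
    (hπ1 : ∀ i, ∑ x, π i x = 1) (u : (Fin n → X) → ℝ) :
    Ec (fun c => ev π (fun z => op (avg π (col (fun _ => true) sC c)) u z ^ 2))
      ≤ (ev π (fun z => |u z| ^ (2 - e))) ^ (2 / (2 - e)) := by
  classical
  have hπ0 : ∀ i x, 0 ≤ π i x := fun i x => hα.le.trans (hπ i x)
  have hmm : (m : ℝ) ≠ 0 := by positivity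
  set R : Fin n → X × Fin m → X → ℝ := fun i p b => if p.2 ∈ sC then π i b else dl p.1 b with hR
  have e1 : Ec (fun c => ev π (fun z => op (avg π (col (fun _ => true) sC c)) u z ^ 2))
      = ev (fun i (p : X × Fin m) => π i p.1 * (m : ℝ)⁻¹) (fun z => op R u z ^ 2) := by
    rw [ev_prod_type π (fun _ _ => (m : ℝ)⁻¹)]
    unfold Ec
    congr 1; funext c; congr 1; funext z; congr 1
    unfold op
    refine Finset.sum_congr rfl fun w _ => ?_
    congr 1
    refine Finset.prod_congr rfl fun i _ => ?_
    simp [avg, col, hR]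
  have hMk : ∀ i b b', ∑ p : X × Fin m, π i p.1 * (m : ℝ)⁻¹ * R i p b * R i p b'
      = Mk ((sC.card : ℝ) / m) (π i) b b' := by
    intro i b b'
    rw [Fintype.sum_prod_type, Finset.sum_comm]
    have : ∀ x : Fin m, ∑ a, π i a * (m : ℝ)⁻¹ * R i (a, x) b * R i (a, x) b'
        = if x ∈ sC then (m : ℝ)⁻¹ * (π i b * π i b') else (m : ℝ)⁻¹ * (π i b * dl b b') := by
      intro x
      simp only [hR]
      split_ifs
      · have : ∀ a, π i a * (m : ℝ)⁻¹ * π i b * π i b' = π i a * ((m : ℝ)⁻¹ * (π i b * π i b')) :=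
          fun a => by ring
        simp only [this]
        rw [← Finset.sum_mul, hπ1, one_mul]
      · have : ∀ a, π i a * (m : ℝ)⁻¹ * dl a b * dl a b'
          = (π i a * (m : ℝ)⁻¹ * dl a b') * dl a b := fun a => by ring
        simp only [this]
        rw [sum_mul_dl]; ring
    simp only [this]
    rw [Finset.sum_ite]
    simp only [Finset.sum_const, nsmul_eq_mul]
    have c1 : (Finset.univ.filter (fun x => x ∈ sC)).card = sC.card := by
      congr 1; ext; simp
    have c2 : ((Finset.univ.filter (fun x => x ∉ sC)).card : ℝ) = m - sC.card := by
      have := Finset.card_filter_add_card_filter_not (s := (Finset.univ : Finset (Fin m)))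
        (fun x => x ∈ sC)
      rw [c1] at this
      simp only [Finset.card_univ, Fintype.card_fin] at this
      rw [eq_sub_iff_add_eq]; exact_mod_cast (by omega)
    rw [c1, c2]
    unfold Mk; field_simp; ring
  rw [e1, ev_sq_op]
  simp only [hMk]
  have T := hyper_tens (s := (sC.card : ℝ) / m) hα (by positivity) hs1 he he0 he1 π hπ hπ1
    (fun x => |u x|) (fun x => |u x|) (fun x => abs_nonneg _) (fun x => abs_nonneg _)
  have nn : 0 ≤ ev π (fun z => |u z| ^ (2 - e)) :=
    ev_nonneg hπ0 fun z => Real.rpow_nonneg (abs_nonneg _) _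
  have hq : 0 ≤ 1 / (2 - e) := div_nonneg zero_le_one (by linarith)
  have sqr : (ev π (fun z => |u z| ^ (2 - e))) ^ (2 / (2 - e))
      = (ev π (fun z => |u z| ^ (2 - e))) ^ (1 / (2 - e))
        * (ev π (fun z => |u z| ^ (2 - e))) ^ (1 / (2 - e)) := by
    rw [← Real.rpow_add_of_nonneg nn hq hq]
    congr 1; ring
  rw [sqr]
  refine le_trans (Finset.sum_le_sum fun x _ => Finset.sum_le_sum fun x' _ => ?_) T
  refine mul_le_mul_of_nonneg_left ?_ (Finset.prod_nonneg fun i _ => ?_)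
  · rw [← abs_mul]; exact le_abs_self _
  · rw [← hMk]
    refine Finset.sum_nonneg fun p _ => ?_
    have : ∀ b, 0 ≤ R i p b := by
      intro b; simp only [hR]; split_ifs
      · exact hπ0 _ _
      · exact dl_nonneg _ _
    have h1 := hπ0 i p.1
    have h2 := this (x i)
    have h3 := this (x' i)
    positivity

end hyper


/-! ### A KKL-type inequality -/

section kkl

variable {n m : ℕ} {X W : Type} [Fintype X] [Fintype W]

lemma op_sq_le {k : Fin n → X → W → ℝ} (h0 : ∀ i a b, 0 ≤ k i a b)
    (h1 : ∀ i a, ∑ b, k i a b = 1) (u : (Fin n → W) → ℝ) (z : Fin n → X) :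
    (op k u z) ^ 2 ≤ op k (fun w => u w ^ 2) z := by
  set θ := op k u z with hθ
  have := op_mono h0 (g := fun w => 2 * θ * u w - θ ^ 2) (h := fun w => u w ^ 2)
    (fun w => by nlinarith [sq_nonneg (u w - θ)]) z
  rw [op_sub, op_smul, op_const h1, ← hθ] at this
  nlinarith

lemma op_abs_le {k : Fin n → X → W → ℝ} (h0 : ∀ i a b, 0 ≤ k i a b)
    (u : (Fin n → W) → ℝ) (z : Fin n → X) :
    |op k u z| ≤ op k (fun w => |u w|) z := by
  rw [abs_le]
  constructor
  · have := op_mono h0 (g := fun w => (-1) * |u w|) (h := u)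
      (fun w => by linarith [neg_abs_le (u w)]) z
    rw [op_smul] at this; linarith
  · exact op_mono h0 (fun w => le_abs_self (u w)) z

lemma rpow_split {x lam e : ℝ} (hx : 0 ≤ x) (hl : 0 < lam) (he0 : 0 ≤ e) (he1 : e ≤ 1) :
    x ^ (1 + e) ≤ lam ^ e * x + lam ^ (e - 1) * x ^ 2 := by
  rcases hx.eq_or_lt with h | h
  · subst h; rw [Real.zero_rpow (by linarith)]; norm_num
  rw [Real.rpow_add h, Real.rpow_one]
  have l1 : 0 < lam ^ e := Real.rpow_pos_of_pos hl _
  have l2 : 0 < lam ^ (e - 1) := Real.rpow_pos_of_pos hl _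
  rcases le_total x lam with h1 | h1
  · have : x ^ e ≤ lam ^ e := Real.rpow_le_rpow hx h1 he0
    have : x * x ^ e ≤ lam ^ e * x := by rw [mul_comm]; exact mul_le_mul_of_nonneg_right this hx
    have : 0 ≤ lam ^ (e - 1) * x ^ 2 := by positivity
    linarith
  · have h2 : x ^ (e - 1) ≤ lam ^ (e - 1) :=
      Real.rpow_le_rpow_of_nonpos hl h1 (by linarith)
    have h3 : x ^ e = x ^ (e - 1) * x := by
      rw [← Real.rpow_add_one h.ne']; congr 1; ring
    have : x * x ^ e ≤ lam ^ (e - 1) * x ^ 2 := by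
      rw [h3]
      calc x * (x ^ (e - 1) * x) = x ^ (e - 1) * x ^ 2 := by ring
        _ ≤ _ := mul_le_mul_of_nonneg_right h2 (by positivity)
    have : 0 ≤ lam ^ e * x := by positivity
    linarith

lemma isP_push {π : Fin n → X → ℝ} (hπ : IsP π) {T : Fin n → X → W → ℝ}
    (hT0 : ∀ i a b, 0 ≤ T i a b) (hT1 : ∀ i a, ∑ b, T i a b = 1) {ν : Fin n → W → ℝ}
    (hν : ∀ i b, ∑ a, π i a * T i a b = ν i b) : IsP ν := by
  constructor
  · intro i b; rw [← hν]
    exact Finset.sum_nonneg fun a _ => mul_nonneg (hπ.1 _ _) (hT0 _ _ _)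
  · intro i
    simp only [← hν]
    rw [Finset.sum_comm]
    simp only [← Finset.mul_sum, hT1, mul_one, hπ.2]

lemma kkl {α e lam τ : ℝ} (hα : 0 < α) (sC : Finset (Fin m)) (b0 : Fin m)
    (hs1 : (sC.card : ℝ) / m < 1) (he : e * (1 + α) = (sC.card : ℝ) / m * α)
    (he0 : 0 ≤ e) (he1 : e < 1) (hlam : 0 < lam) (hτ : 0 ≤ τ)
    (π : Fin n → X → ℝ) (hπ : ∀ i x, α ≤ π i x) (hπ1 : ∀ i, ∑ x, π i x = 1)
    (T : Fin n → X → W → ℝ) (hT0 : ∀ i a b, 0 ≤ T i a b) (hT1 : ∀ i a, ∑ b, T i a b = 1)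
    (ν : Fin n → W → ℝ) (hν : ∀ i b, ∑ a, π i a * T i a b = ν i b)
    (h : (Fin n → W) → ℝ) (hb : ∀ z, h z = 0 ∨ h z = 1)
    (hinf : ∀ i, aS ν h (sgl i) ≤ τ) (V : ℝ) (hV : V = Ec (fun c => aS ν h (cl b0 c))) :
    (ev π (fun z => op T h z ^ 2) - (ev π (op T h)) ^ 2 - sC.card * V) / m
      ≤ 2 * lam ^ (e / (2 - e)) * V + 8 * lam ^ (e / (2 - e) - 1) * V * (τ + V) := by
  have hm : 0 < m := b0.pos
  have hmm : (0:ℝ) < m := by positivity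
  have hπP : IsP π := ⟨fun i x => hα.le.trans (hπ i x), hπ1⟩
  have hνP : IsP ν := isP_push hπP hT0 hT1 hν
  set g := op T h with hg
  have hp : 0 < 2 - e := by linarith
  set e' := e / (2 - e) with he'
  have he'0 : 0 ≤ e' := div_nonneg he0 hp.le
  have he'1 : e' ≤ 1 := by rw [he', div_le_one hp]; linarith
  have hexp : 2 / (2 - e) = 1 + e' := by rw [he']; field_simp; ring
  have hm01 : ∀ z, h z ∈ Set.Icc (0:ℝ) 1 := fun z => by rcases hb z with e | e <;> rw [e] <;> simp
  -- difference operators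
  have hdiff : ∀ S, ∀ z, g z - op (avg π S) g z = op T (fun w => h w - op (avg ν S) h w) z := by
    intro S z
    rw [op_sub, intertwine T hT1 hν, ← hg]
  have hag : ∀ S, aS π g S ≤ aS ν h S := by
    intro S
    rw [aS_eq_sq hπP, aS_eq_sq hνP]
    simp only [hdiff]
    calc _ ≤ ev π (op T (fun w => (h w - op (avg ν S) h w) ^ 2)) :=
          ev_mono hπP.1 fun z => op_sq_le hT0 hT1 _ z
      _ = _ := by rw [ev_op]; simp only [hν]
  have hNp : ∀ S, ev π (fun z => |g z - op (avg π S) g z| ^ (2 - e)) ≤ 2 * aS ν h S := by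
    intro S
    rw [← aS_bool hνP hb]
    have hu1 : ∀ w, |h w - op (avg ν S) h w| ≤ 1 := by
      intro w
      have h1 := hm01 w
      have h2 := op_mem (avg_nonneg hνP S) (avg_sum hνP S) hm01 w
      rw [abs_le]; constructor <;> linarith [h1.1, h1.2, h2.1, h2.2]
    calc _ ≤ ev π (op T (fun w => |h w - op (avg ν S) h w|)) := by
          refine ev_mono hπP.1 fun z => ?_
          rw [hdiff]
          have h1 := op_abs_le hT0 (fun w => h w - op (avg ν S) h w) z
          have h2 : op T (fun w => |h w - op (avg ν S) h w|) z ≤ 1 := by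
            have := op_mono hT0 hu1 z
            rwa [op_const hT1] at this
          refine le_trans ?_ h1
          calc _ ≤ |op T (fun w => h w - op (avg ν S) h w) z| ^ (1:ℝ) :=
                Real.rpow_le_rpow_of_exponent_ge_of_imp (abs_nonneg _) (h1.trans h2) (by linarith)
                  (fun _ hh => absurd hh hp.ne')
            _ = _ := Real.rpow_one _
      _ = _ := by rw [ev_op]; simp only [hν]
  -- the chain
  have hvar : ev π (fun z => g z ^ 2) - (ev π g) ^ 2 = aS π g (fun _ => true) := (aS_top hπP g).symm
  rw [hvar]
  have hL : ∀ c' : Fin n → Fin m, (aS π g (fun _ => true) - aS π g (col (fun _ => true) sC c')) / m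
      ≤ Ec (fun c => ev π (fun z => op (avg π (col (fun _ => true) sC c'))
          (fun w => g w - op (avg π (cl b0 c)) g w) z ^ 2)) := by
    intro c'
    set S' := col (fun _ => true) sC c'
    have h1 := Ec_col_ge (a := aS π (op (avg π S') g)) (aS_bot _) (aS_sup hπP _) (fun _ => true) b0
    have h2 := aS_sup_eq hπP g (fun _ => true) S'
    have h3 : (fun _ => true) ⊔ S' = fun _ => true := by funext i; simp
    rw [h3] at h2
    have h4 : aS π (op (avg π S') g) (fun _ => true) = aS π g (fun _ => true) - aS π g S' := by
      linarith
    rw [h4] at h1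
    simp only [cl_eq_col, aS_avg_eq hπP] at h1
    exact h1
  have hswap : Ec (fun c' : Fin n → Fin m => Ec (fun c : Fin n → Fin m =>
        ev π (fun z => op (avg π (col (fun _ => true) sC c'))
          (fun w => g w - op (avg π (cl b0 c)) g w) z ^ 2)))
      = Ec (fun c => Ec (fun c' => ev π (fun z => op (avg π (col (fun _ => true) sC c'))
          (fun w => g w - op (avg π (cl b0 c)) g w) z ^ 2))) := by
    unfold Ec
    simp only [ev, Finset.mul_sum]
    rw [Finset.sum_comm]
  have hR : ∀ c : Fin n → Fin m, Ec (fun c' => ev π (fun z => op (avg π (col (fun _ => true) sC c'))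
          (fun w => g w - op (avg π (cl b0 c)) g w) z ^ 2))
      ≤ 2 * lam ^ e' * aS ν h (cl b0 c) + 4 * lam ^ (e' - 1) * aS ν h (cl b0 c) ^ 2 := by
    intro c
    have h1 := hyper hα sC hs1 hm he he0 he1 π hπ hπ1 (fun w => g w - op (avg π (cl b0 c)) g w)
    refine h1.trans ?_
    rw [hexp]
    have h0 : 0 ≤ ev π (fun z => |g z - op (avg π (cl b0 c)) g z| ^ (2 - e)) :=
      ev_nonneg hπP.1 fun z => Real.rpow_nonneg (abs_nonneg _) _
    have h2 := Real.rpow_le_rpow h0 (hNp (cl b0 c)) (show 0 ≤ 1 + e' by linarith)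
    refine h2.trans ((rpow_split (mul_nonneg zero_le_two (aS_nonneg hνP h _)) hlam he'0 he'1).trans
      (le_of_eq ?_))
    ring
  have h2m : Ec (fun c => aS ν h (cl b0 c) ^ 2) ≤ 2 * V * (τ + V) := by
    have := second_moment b0 τ hτ (aS ν h) (aS ν h) (fun S T hST => aS_mono hνP h hST)
      (aS_sup hνP h) (fun S T hST => aS_mono hνP h hST) hinf (aS_nonneg hνP h)
    rw [aS_bot] at this
    simpa only [sub_zero, ← hV] using this
  have hk : Ec (fun c' : Fin n → Fin m => aS π g (col (fun _ => true) sC c')) ≤ sC.card * V := by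
    refine (Ec_mono _ _ fun c => hag _).trans ?_
    have := Ec_col_le (a := aS ν h) (aS_bot _) (aS_sup hνP h) (fun _ => true) sC b0
    simpa only [cl_eq_col, ← hV] using this
  calc (aS π g (fun _ => true) - sC.card * V) / m
      ≤ (aS π g (fun _ => true)
          - Ec (fun c' : Fin n → Fin m => aS π g (col (fun _ => true) sC c'))) / m := by
        gcongr
    _ = Ec (fun c' : Fin n → Fin m =>
        (aS π g (fun _ => true) - aS π g (col (fun _ => true) sC c')) / m) := by
        have : (fun c' : Fin n → Fin m =>
            (aS π g (fun _ => true) - aS π g (col (fun _ => true) sC c')) / m)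
          = fun c' => (m:ℝ)⁻¹ * (aS π g (fun _ => true) - aS π g (col (fun _ => true) sC c')) := by
          funext c'; ring
        rw [this]
        have hc := Ec_const (n := n) hm (aS π g (fun _ => true))
        unfold Ec at hc ⊢
        rw [ev_smul, ev_sub, hc]; ring
    _ ≤ _ := Ec_mono _ _ hL
    _ = _ := hswap
    _ ≤ _ := Ec_mono _ _ hR
    _ = 2 * lam ^ e' * V + 4 * lam ^ (e' - 1) * Ec (fun c => aS ν h (cl b0 c) ^ 2) := by
        rw [hV]; unfold Ec; rw [ev_add, ev_smul, ev_smul]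
    _ ≤ _ := by
        have : 0 ≤ 4 * lam ^ (e' - 1) := by positivity
        nlinarith [mul_le_mul_of_nonneg_left h2m this]

end kkl


/-! ### Interpolating kernels on `X ⊕ Y` -/

section kernels

variable {n m : ℕ} {X Y : Type} [Fintype X] [Fintype Y]

lemma jensen_sq {Z : Type} [Fintype Z] (w : Z → ℝ) (h0 : ∀ z, 0 ≤ w z) (h1 : ∑ z, w z = 1)
    (u : Z → ℝ) : (∑ z, w z * u z) ^ 2 ≤ ∑ z, w z * u z ^ 2 := by
  set M := ∑ z, w z * u z with hM
  have h : 0 ≤ ∑ z, w z * (u z - M) ^ 2 :=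
    Finset.sum_nonneg fun z _ => mul_nonneg (h0 z) (sq_nonneg _)
  have e : ∀ N : ℝ, ∑ z, w z * (u z - N) ^ 2
      = ∑ z, w z * u z ^ 2 - 2 * N * ∑ z, w z * u z + N ^ 2 * ∑ z, w z := by
    intro N
    rw [Finset.mul_sum, Finset.mul_sum, ← Finset.sum_sub_distrib, ← Finset.sum_add_distrib]
    exact Finset.sum_congr rfl fun z _ => by ring
  rw [e, h1, ← hM] at h
  nlinarith

noncomputable def mX (P : X → Y → ℝ) (x : X) : ℝ := ∑ y, P x y
noncomputable def mY (P : X → Y → ℝ) (y : Y) : ℝ := ∑ x, P x y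
noncomputable def Cc (P : X → Y → ℝ) (x : X) (y : Y) : ℝ := P x y / mX P x

noncomputable def nuq (P : X → Y → ℝ) (q : ℝ) : X ⊕ Y → ℝ :=
  Sum.elim (fun x => q * mX P x) (fun y => (1 - q) * mY P y)

noncomputable def Tq (P : X → Y → ℝ) (q : ℝ) (x : X) : X ⊕ Y → ℝ :=
  Sum.elim (fun x' => q * dl x x') (fun y => (1 - q) * Cc P x y)

noncomputable def Kq (P : X → Y → ℝ) (q q' : ℝ) : X ⊕ Y → X ⊕ Y → ℝ :=
  Sum.elim (fun x => Sum.elim (fun x' => q / q' * dl x x') (fun y => (1 - q / q') * Cc P x y))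
    (fun y => Sum.elim (fun _ => 0) (fun y' => dl y y'))

/-- A correlated pair. -/
structure Pair (α ρ : ℝ) (P : X → Y → ℝ) : Prop where
  nn : ∀ x y, 0 ≤ P x y
  tot : ∑ x, ∑ y, P x y = 1
  lb : ∀ x, α ≤ mX P x
  corr : ∀ (u : X → ℝ) (v : Y → ℝ),
    2 * (∑ x, ∑ y, P x y * (u x * v y) - (∑ x, mX P x * u x) * ∑ y, mY P y * v y)
      ≤ ρ * ((∑ x, mX P x * u x ^ 2 - (∑ x, mX P x * u x) ^ 2)
        + (∑ y, mY P y * v y ^ 2 - (∑ y, mY P y * v y) ^ 2))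

variable {α ρ : ℝ} {P : X → Y → ℝ}

lemma Pair.mX_pos (hα : 0 < α) (h : Pair α ρ P) (x : X) : 0 < mX P x := lt_of_lt_of_le hα (h.lb x)
lemma Pair.mY_nonneg (h : Pair α ρ P) (y : Y) : 0 ≤ mY P y := Finset.sum_nonneg fun x _ => h.nn x y
lemma Pair.sum_mX (h : Pair α ρ P) : ∑ x, mX P x = 1 := h.tot
lemma Pair.sum_mY (h : Pair α ρ P) : ∑ y, mY P y = 1 := by
  unfold mY; rw [Finset.sum_comm]; exact h.tot
lemma Pair.Cc_nonneg (hα : 0 < α) (h : Pair α ρ P) (x : X) (y : Y) : 0 ≤ Cc P x y :=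
  div_nonneg (h.nn x y) (h.mX_pos hα x).le
lemma Pair.Cc_sum (hα : 0 < α) (h : Pair α ρ P) (x : X) : ∑ y, Cc P x y = 1 := by
  unfold Cc; rw [← Finset.sum_div]; exact div_self (h.mX_pos hα x).ne'
lemma Pair.mX_Cc (hα : 0 < α) (h : Pair α ρ P) (x : X) (y : Y) : mX P x * Cc P x y = P x y :=
  mul_div_cancel₀ _ (h.mX_pos hα x).ne'

lemma Tq_nonneg (hα : 0 < α) (h : Pair α ρ P) {q : ℝ} (hq0 : 0 ≤ q) (hq1 : q ≤ 1) (x : X)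
    (w : X ⊕ Y) : 0 ≤ Tq P q x w := by
  rcases w with w | w
  · exact mul_nonneg hq0 (dl_nonneg _ _)
  · exact mul_nonneg (by linarith) (h.Cc_nonneg hα _ _)

lemma Tq_sum (hα : 0 < α) (h : Pair α ρ P) (q : ℝ) (x : X) : ∑ w, Tq P q x w = 1 := by
  rw [Fintype.sum_sum_type]
  simp only [Tq, Sum.elim_inl, Sum.elim_inr, ← Finset.mul_sum, sum_dl, h.Cc_sum hα]; ring

lemma push_Tq (hα : 0 < α) (h : Pair α ρ P) (q : ℝ) (w : X ⊕ Y) :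
    ∑ x, mX P x * Tq P q x w = nuq P q w := by
  rcases w with w | w
  · simp only [Tq, nuq, Sum.elim_inl]
    have : ∀ x, mX P x * (q * dl x w) = (q * mX P x) * dl x w := fun x => by ring
    simp only [this]; rw [sum_mul_dl]
  · simp only [Tq, nuq, Sum.elim_inr]
    have : ∀ x, mX P x * ((1 - q) * Cc P x w) = (1 - q) * P x w := fun x => by
      rw [← h.mX_Cc hα x w]; ring
    simp only [this]; rw [← Finset.mul_sum]; rfl

lemma Tq_Kq {q q' : ℝ} (hq' : q' ≠ 0) (x : X) (w : X ⊕ Y) :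
    ∑ v, Tq P q' x v * Kq P q q' v w = Tq P q x w := by
  rw [Fintype.sum_sum_type]
  rcases w with w | w
  · simp only [Tq, Kq, Sum.elim_inl, Sum.elim_inr, mul_zero, Finset.sum_const_zero, add_zero]
    have : ∀ x', q' * dl x x' * (q / q' * dl x' w) = dl x x' * (q * dl x' w) := fun x' => by
      field_simp
    simp only [this]; rw [sum_dl_mul]
  · simp only [Tq, Kq, Sum.elim_inl, Sum.elim_inr]
    have : ∀ x', q' * dl x x' * ((1 - q / q') * Cc P x' w) = dl x x' * ((q' - q) * Cc P x' w) :=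
      fun x' => by field_simp
    simp only [this]; rw [sum_dl_mul, sum_mul_dl]; ring

lemma Kq_nonneg (hα : 0 < α) (h : Pair α ρ P) {q q' : ℝ} (hq0 : 0 ≤ q) (hq' : 0 < q')
    (hqq : q ≤ q') (v w : X ⊕ Y) : 0 ≤ Kq P q q' v w := by
  have h1 : 0 ≤ q / q' := by positivity
  have h2 : q / q' ≤ 1 := by rw [div_le_one hq']; exact hqq
  rcases v with v | v <;> rcases w with w | w <;> simp only [Kq, Sum.elim_inl, Sum.elim_inr]
  · exact mul_nonneg h1 (dl_nonneg _ _)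
  · exact mul_nonneg (by linarith) (h.Cc_nonneg hα _ _)
  · exact le_rfl
  · exact dl_nonneg _ _

lemma Kq_sum (hα : 0 < α) (h : Pair α ρ P) (q q' : ℝ) (v : X ⊕ Y) : ∑ w, Kq P q q' v w = 1 := by
  rw [Fintype.sum_sum_type]
  rcases v with v | v
  · simp only [Kq, Sum.elim_inl, Sum.elim_inr, ← Finset.mul_sum, sum_dl, h.Cc_sum hα]; ring
  · simp only [Kq, Sum.elim_inl, Sum.elim_inr, sum_dl, Finset.sum_const_zero, zero_add]

lemma push_Kq (hα : 0 < α) (h : Pair α ρ P) {q q' : ℝ} (hq' : q' ≠ 0) (w : X ⊕ Y) :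
    ∑ v, nuq P q' v * Kq P q q' v w = nuq P q w := by
  simp only [← push_Tq hα h, Finset.sum_mul]
  rw [Finset.sum_comm]
  refine Finset.sum_congr rfl fun x _ => ?_
  rw [← Tq_Kq (P := P) hq', Finset.mul_sum]
  exact Finset.sum_congr rfl fun v _ => by ring

/-- Spectral gap: the Dirichlet form dominates the variance under `nuq`. -/
lemma gap (h : Pair α ρ P) (hρ0 : 0 ≤ ρ) (hρ1 : ρ ≤ 1) {q : ℝ} (hq0 : 0 ≤ q) (hq1 : q ≤ 1)
    (u : X ⊕ Y → ℝ) :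
    (1 - ρ) * (∑ w, nuq P q w * u w ^ 2 - (∑ w, nuq P q w * u w) ^ 2)
      ≤ ∑ x, ∑ y, P x y * (u (Sum.inl x) - u (Sum.inr y)) ^ 2 := by
  have c := h.corr (fun x => u (Sum.inl x)) (fun y => u (Sum.inr y))
  set A1 := ∑ x, mX P x * u (Sum.inl x) with hA1
  set A2 := ∑ x, mX P x * u (Sum.inl x) ^ 2 with hA2
  set B1 := ∑ y, mY P y * u (Sum.inr y) with hB1
  set B2 := ∑ y, mY P y * u (Sum.inr y) ^ 2 with hB2
  set D := ∑ x, ∑ y, P x y * (u (Sum.inl x) * u (Sum.inr y)) with hD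
  have e1 : ∑ x, ∑ y, P x y * (u (Sum.inl x) - u (Sum.inr y)) ^ 2 = A2 + B2 - 2 * D := by
    have t1 : A2 = ∑ x, ∑ y, P x y * u (Sum.inl x) ^ 2 := by
      rw [hA2]; exact Finset.sum_congr rfl fun x _ => by rw [mX, Finset.sum_mul]
    have t2 : B2 = ∑ x, ∑ y, P x y * u (Sum.inr y) ^ 2 := by
      rw [Finset.sum_comm, hB2]; exact Finset.sum_congr rfl fun x _ => by rw [mY, Finset.sum_mul]
    rw [t1, t2, hD, Finset.mul_sum, ← Finset.sum_add_distrib, ← Finset.sum_sub_distrib]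
    refine Finset.sum_congr rfl fun x _ => ?_
    rw [Finset.mul_sum, ← Finset.sum_add_distrib, ← Finset.sum_sub_distrib]
    exact Finset.sum_congr rfl fun y _ => by ring
  have e2 : ∑ w, nuq P q w * u w ^ 2 = q * A2 + (1 - q) * B2 := by
    rw [Fintype.sum_sum_type, hA2, hB2, Finset.mul_sum, Finset.mul_sum]
    simp only [nuq, Sum.elim_inl, Sum.elim_inr, mul_assoc]
  have e3 : ∑ w, nuq P q w * u w = q * A1 + (1 - q) * B1 := by
    rw [Fintype.sum_sum_type, hA1, hB1, Finset.mul_sum, Finset.mul_sum]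
    simp only [nuq, Sum.elim_inl, Sum.elim_inr, mul_assoc]
  have vA : A1 ^ 2 ≤ A2 := by
    have := jensen_sq (mX P) (fun x => Finset.sum_nonneg fun y _ => h.nn x y)
      h.sum_mX (fun x => u (Sum.inl x))
    exact this
  have vB : B1 ^ 2 ≤ B2 := by
    have := jensen_sq (mY P) h.mY_nonneg
      h.sum_mY (fun x => u (Sum.inr x))
    exact this
  rw [e1, e2, e3]
  clear_value A1 A2 B1 B2 D
  have s1 : q * A2 + (1 - q) * B2 - (q * A1 + (1 - q) * B1) ^ 2
      = q * (A2 - A1 ^ 2) + (1 - q) * (B2 - B1 ^ 2) + q * (1 - q) * (A1 - B1) ^ 2 := by ring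
  have s2 : q * (A2 - A1 ^ 2) ≤ A2 - A1 ^ 2 := by nlinarith
  have s3 : (1 - q) * (B2 - B1 ^ 2) ≤ B2 - B1 ^ 2 := by nlinarith
  have s4 : q * (1 - q) * (A1 - B1) ^ 2 ≤ (A1 - B1) ^ 2 := by
    have : q * (1 - q) ≤ 1 := by nlinarith
    nlinarith [sq_nonneg (A1 - B1)]
  rw [s1]
  have s5 : (1 - ρ) * (q * (A2 - A1 ^ 2) + (1 - q) * (B2 - B1 ^ 2) + q * (1 - q) * (A1 - B1) ^ 2)
      ≤ (1 - ρ) * ((A2 - A1 ^ 2) + (B2 - B1 ^ 2) + (A1 - B1) ^ 2) :=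
    mul_le_mul_of_nonneg_left (by linarith) (by linarith)
  nlinarith [mul_nonneg hρ0 (sq_nonneg (A1 - B1))]

lemma contr_one (hα : 0 < α) (h : Pair α ρ P) {q q' : ℝ} (hq0 : 0 ≤ q) (hq' : 0 < q')
    (hqq : q ≤ q') (hq1 : q' ≤ 1) (u : X ⊕ Y → ℝ) :
    ∑ v, nuq P q' v * (∑ w, Kq P q q' v w * u w) ^ 2
      ≤ ∑ w, nuq P q w * u w ^ 2
        - q * (q' - q) / q' * ∑ x, ∑ y, P x y * (u (Sum.inl x) - u (Sum.inr y)) ^ 2 := by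
  have hpt : ∀ x, (∑ w, Kq P q q' (Sum.inl x) w * u w) ^ 2
      ≤ ∑ y, Cc P x y * (q / q' * u (Sum.inl x) + (1 - q / q') * u (Sum.inr y)) ^ 2 := by
    intro x
    have := jensen_sq (Cc P x) (h.Cc_nonneg hα x) (h.Cc_sum hα x)
      (fun y => q / q' * u (Sum.inl x) + (1 - q / q') * u (Sum.inr y))
    refine le_trans (le_of_eq ?_) this
    congr 1
    rw [Fintype.sum_sum_type]
    simp only [Kq, Sum.elim_inl, Sum.elim_inr, mul_add, Finset.sum_add_distrib]
    rw [← Finset.sum_mul, h.Cc_sum hα]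
    congr 1
    · have : ∀ x', q / q' * dl x x' * u (Sum.inl x') = dl x x' * (q / q' * u (Sum.inl x')) :=
        fun x' => by ring
      simp only [this]; rw [sum_dl_mul]; ring
    · exact Finset.sum_congr rfl fun y _ => by ring
  have hinr : ∀ y, ∑ w, Kq P q q' (Sum.inr y) w * u w = u (Sum.inr y) := by
    intro y
    rw [Fintype.sum_sum_type]
    simp only [Kq, Sum.elim_inl, Sum.elim_inr, zero_mul, Finset.sum_const_zero, zero_add]
    rw [sum_dl_mul]
  rw [Fintype.sum_sum_type]
  simp only [hinr]
  have t1 : ∑ x, nuq P q' (Sum.inl x) * (∑ w, Kq P q q' (Sum.inl x) w * u w) ^ 2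
      ≤ ∑ x, ∑ y, P x y * (q * u (Sum.inl x) ^ 2 + (q' - q) * u (Sum.inr y) ^ 2
        - q * (q' - q) / q' * (u (Sum.inl x) - u (Sum.inr y)) ^ 2) := by
    refine Finset.sum_le_sum fun x _ => ?_
    refine (mul_le_mul_of_nonneg_left (hpt x) (mul_nonneg hq'.le (h.mX_pos hα x).le)).trans
      (le_of_eq ?_)
    rw [Finset.mul_sum]
    refine Finset.sum_congr rfl fun y _ => ?_
    rw [← h.mX_Cc hα x y]
    field_simp; ring
  have t2 : ∑ x, ∑ y, P x y * (q * u (Sum.inl x) ^ 2 + (q' - q) * u (Sum.inr y) ^ 2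
        - q * (q' - q) / q' * (u (Sum.inl x) - u (Sum.inr y)) ^ 2)
      = q * (∑ x, mX P x * u (Sum.inl x) ^ 2) + (q' - q) * (∑ y, mY P y * u (Sum.inr y) ^ 2)
        - q * (q' - q) / q' * ∑ x, ∑ y, P x y * (u (Sum.inl x) - u (Sum.inr y)) ^ 2 := by
    have t1 : ∑ x, mX P x * u (Sum.inl x) ^ 2 = ∑ x, ∑ y, P x y * u (Sum.inl x) ^ 2 :=
      Finset.sum_congr rfl fun x _ => by rw [mX, Finset.sum_mul]
    have t2 : ∑ y, mY P y * u (Sum.inr y) ^ 2 = ∑ x, ∑ y, P x y * u (Sum.inr y) ^ 2 := by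
      rw [Finset.sum_comm]; exact Finset.sum_congr rfl fun x _ => by rw [mY, Finset.sum_mul]
    rw [t1, t2]
    simp only [Finset.mul_sum, ← Finset.sum_add_distrib, ← Finset.sum_sub_distrib]
    exact Finset.sum_congr rfl fun x _ => Finset.sum_congr rfl fun y _ => by ring
  have t3 : ∑ y, nuq P q' (Sum.inr y) * u (Sum.inr y) ^ 2
      = (1 - q') * ∑ y, mY P y * u (Sum.inr y) ^ 2 := by
    rw [Finset.mul_sum]; simp only [nuq, Sum.elim_inr, mul_assoc]
  have t4 : ∑ w, nuq P q w * u w ^ 2 = q * (∑ x, mX P x * u (Sum.inl x) ^ 2)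
      + (1 - q) * ∑ y, mY P y * u (Sum.inr y) ^ 2 := by
    rw [Fintype.sum_sum_type, Finset.mul_sum, Finset.mul_sum]
    simp only [nuq, Sum.elim_inl, Sum.elim_inr, mul_assoc]
  rw [t3, t4]
  linarith [t1, t2]

end kernels


/-! ### Tensorized contraction and the thresholding step -/

section step

variable {n m : ℕ} {X Y : Type} [Fintype X] [Fintype Y] {α ρ : ℝ} {P : Fin n → X → Y → ℝ}

noncomputable def nuF (P : Fin n → X → Y → ℝ) (q : Fin n → ℝ) (i : Fin n) : X ⊕ Y → ℝ :=
  nuq (P i) (q i)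
noncomputable def TF (P : Fin n → X → Y → ℝ) (q : Fin n → ℝ) (i : Fin n) : X → X ⊕ Y → ℝ :=
  Tq (P i) (q i)
noncomputable def KF (P : Fin n → X → Y → ℝ) (q q' : Fin n → ℝ) (i : Fin n) :
    X ⊕ Y → X ⊕ Y → ℝ :=
  Kq (P i) (q i) (q' i)
noncomputable def pX (P : Fin n → X → Y → ℝ) (i : Fin n) : X → ℝ := mX (P i)

lemma isP_pX (hα : 0 < α) (hP : ∀ i, Pair α ρ (P i)) : IsP (pX P) :=
  ⟨fun i x => ((hP i).mX_pos hα x).le, fun i => (hP i).sum_mX⟩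

lemma isP_nuF (hα : 0 < α) (hP : ∀ i, Pair α ρ (P i)) {q : Fin n → ℝ} (hq0 : ∀ i, 0 ≤ q i)
    (hq1 : ∀ i, q i ≤ 1) : IsP (nuF P q) :=
  isP_push (isP_pX hα hP) (T := TF P q)
    (fun i a b => Tq_nonneg hα (hP i) (hq0 i) (hq1 i) a b)
    (fun i a => Tq_sum hα (hP i) _ a) (fun i b => push_Tq hα (hP i) _ b)


lemma op_TF_KF {q q' : Fin n → ℝ} (hq' : ∀ i, q' i ≠ 0) (h : (Fin n → X ⊕ Y) → ℝ)
    (z : Fin n → X) : op (TF P q') (op (KF P q q') h) z = op (TF P q) h z := by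
  rw [op_comp]
  congr 1
  funext i a c
  exact Tq_Kq (hq' i) a c

lemma ev_KF (hα : 0 < α) (hP : ∀ i, Pair α ρ (P i)) {q q' : Fin n → ℝ} (hq' : ∀ i, q' i ≠ 0)
    (h : (Fin n → X ⊕ Y) → ℝ) : ev (nuF P q') (op (KF P q q') h) = ev (nuF P q) h := by
  rw [ev_op]
  congr 1
  funext i c
  exact push_Kq hα (hP i) (hq' i) c

lemma ev_TF (hα : 0 < α) (hP : ∀ i, Pair α ρ (P i)) {q : Fin n → ℝ}
    (h : (Fin n → X ⊕ Y) → ℝ) : ev (pX P) (op (TF P q) h) = ev (nuF P q) h := by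
  rw [ev_op]
  congr 1
  funext i c
  exact push_Tq hα (hP i) _ c

lemma contraction (hα : 0 < α) (hρ0 : 0 ≤ ρ) (hρ1 : ρ ≤ 1) (hP : ∀ i, Pair α ρ (P i))
    {q q' : Fin n → ℝ} (hq0 : ∀ i, 0 < q i) (hqq : ∀ i, q i ≤ q' i) (hq1 : ∀ i, q' i ≤ 1)
    (b0 : Fin m) (J : Fin n → Bool)
    (hJ : ∀ i, J i = true → (m : ℝ)⁻¹ ≤ q i * (q' i - q i) / q' i * (1 - ρ))
    (h : (Fin n → X ⊕ Y) → ℝ) :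
    ev (nuF P q') (fun z => op (KF P q q') h z ^ 2)
      ≤ ev (nuF P q) (fun z => h z ^ 2) - Ec (fun c => aS (nuF P q) h (col J {b0} c)) := by
  classical
  have hm : 0 < m := b0.pos
  have hmm : (m : ℝ) ≠ 0 := by positivity
  have hν : IsP (nuF P q) := isP_nuF hα hP (fun i => (hq0 i).le) (fun i => (hqq i).trans (hq1 i))
  have hν' : IsP (nuF P q') := isP_nuF hα hP (fun i => (hq0 i).le.trans (hqq i)) hq1
  have hq0' : ∀ i, 0 < q' i := fun i => (hq0 i).trans_le (hqq i)
  set R : Fin n → (X ⊕ Y) × Fin m → X ⊕ Y → ℝ :=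
    fun i p b => if (J i = true ∧ p.2 = b0) then nuF P q i b else dl p.1 b with hR
  have e1 : ev (nuF P q) (fun z => h z ^ 2) - Ec (fun c => aS (nuF P q) h (col J {b0} c))
      = ev (fun i (p : (X ⊕ Y) × Fin m) => nuF P q i p.1 * (m : ℝ)⁻¹) (fun z => op R h z ^ 2) := by
    rw [ev_prod_type (nuF P q) (fun _ _ => (m : ℝ)⁻¹)]
    have : Ec (fun c => aS (nuF P q) h (col J {b0} c))
      = ev (nuF P q) (fun z => h z ^ 2)
        - Ec (fun c => ev (nuF P q) (fun z => op (avg (nuF P q) (col J {b0} c)) h z ^ 2)) := by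
      have hc := Ec_const (n := n) hm (ev (nuF P q) (fun z => h z ^ 2))
      unfold Ec aS at *
      rw [ev_sub, hc]
    rw [this, sub_sub_cancel]
    unfold Ec
    congr 1; funext c; congr 1; funext z; congr 1
    unfold op
    refine Finset.sum_congr rfl fun w _ => ?_
    congr 1
    refine Finset.prod_congr rfl fun i _ => ?_
    simp [avg, col, hR]
  rw [e1]
  refine tens (nuF P q') _ (KF P q q') R hν'.1
    (fun i p => mul_nonneg (hν.1 i p.1) (by positivity)) (fun i u => ?_) h
  have hc := contr_one hα (hP i) (hq0 i).le (hq0' i) (hqq i) (hq1 i) u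
  have hg := gap (hP i) hρ0 hρ1 (hq0 i).le ((hqq i).trans (hq1 i)) u
  have hD : 0 ≤ ∑ x, ∑ y, P i x y * (u (Sum.inl x) - u (Sum.inr y)) ^ 2 :=
    Finset.sum_nonneg fun x _ => Finset.sum_nonneg fun y _ => mul_nonneg ((hP i).nn _ _) (sq_nonneg _)
  set D := ∑ x, ∑ y, P i x y * (u (Sum.inl x) - u (Sum.inr y)) ^ 2
  have hv := jensen_sq (nuF P q i) (hν.1 i) (hν.2 i) u
  have hκ : 0 ≤ q i * (q' i - q i) / q' i :=
    div_nonneg (mul_nonneg (hq0 i).le (sub_nonneg.2 (hqq i))) (hq0' i).le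
  have e2 : ∑ p : (X ⊕ Y) × Fin m, nuF P q i p.1 * (m : ℝ)⁻¹ * (∑ c, R i p c * u c) ^ 2
      = ∑ w, nuF P q i w * u w ^ 2 - (if J i = true then (m : ℝ)⁻¹ else 0)
        * (∑ w, nuF P q i w * u w ^ 2 - (∑ w, nuF P q i w * u w) ^ 2) := by
    rw [Fintype.sum_prod_type, Finset.sum_comm]
    have : ∀ x : Fin m, ∑ w, nuF P q i w * (m : ℝ)⁻¹ * (∑ c, R i (w, x) c * u c) ^ 2
        = (m : ℝ)⁻¹ * (∑ w, nuF P q i w * u w ^ 2)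
          - (if x = b0 then (if J i = true then (m : ℝ)⁻¹ else 0)
            * (∑ w, nuF P q i w * u w ^ 2 - (∑ w, nuF P q i w * u w) ^ 2) else 0) := by
      intro x
      by_cases hx : x = b0 <;> by_cases hj : J i = true <;>
        simp only [hR, hx, hj, and_self, and_true, true_and, and_false, false_and, if_true, if_false]
      · have : ∀ w, nuF P q i w * (m : ℝ)⁻¹ * (∑ c, nuF P q i c * u c) ^ 2
          = nuF P q i w * ((m : ℝ)⁻¹ * (∑ c, nuF P q i c * u c) ^ 2) := fun w => by ring
        simp only [this]
        rw [← Finset.sum_mul, hν.2]; ring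
      all_goals
        simp only [sum_dl_mul, Finset.mul_sum, zero_mul, sub_zero, Bool.false_eq_true, if_false]
        refine Finset.sum_congr rfl fun w _ => ?_
        ring
    simp only [this]
    rw [Finset.sum_sub_distrib, Finset.sum_ite_eq' Finset.univ b0]
    simp [hmm]
  rw [e2]
  refine hc.trans ?_
  have key : (if J i = true then (m : ℝ)⁻¹ else 0)
        * (∑ w, nuF P q i w * u w ^ 2 - (∑ w, nuF P q i w * u w) ^ 2)
      ≤ q i * (q' i - q i) / q' i * D := by
    split_ifs with hj
    · have h1 := mul_le_mul_of_nonneg_right (hJ i hj) (sub_nonneg.2 hv)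
      have h2 := mul_le_mul_of_nonneg_left hg hκ
      unfold nuF at *
      linarith
    · rw [zero_mul]; exact mul_nonneg hκ hD
  have : ∑ w, nuq (P i) (q i) w * u w ^ 2 = ∑ w, nuF P q i w * u w ^ 2 := rfl
  linarith

open Classical in
/-- thresholding -/
noncomputable def thr {A : Type} (ε : ℝ) (y : A → ℝ) (z : A) : ℝ := if ε ≤ y z then 1 else 0

lemma thr_bool {A : Type} (ε : ℝ) (y : A → ℝ) (z : A) : thr ε y z = 0 ∨ thr ε y z = 1 := by
  unfold thr; split_ifs <;> simp

lemma thr_mul_le {A : Type} {ε : ℝ} {y : A → ℝ} (hy : ∀ z, 0 ≤ y z) (z : A) :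
    ε * thr ε y z ≤ y z := by
  unfold thr; split_ifs with h
  · linarith
  · rw [mul_zero]; exact hy z

lemma le_thr {A : Type} {ε : ℝ} (hε : 0 ≤ ε) {y : A → ℝ} (z : A) :
    2 * y z - y z ^ 2 - 2 * ε ≤ thr ε y z := by
  unfold thr; split_ifs with h
  · nlinarith [sq_nonneg (y z - 1)]
  · nlinarith [sq_nonneg (y z)]

lemma le_thr' {A : Type} {ε : ℝ} (hε : 0 ≤ ε) {y : A → ℝ} (hy : ∀ z, y z ≤ 1) (z : A) :
    y z - ε ≤ thr ε y z := by
  unfold thr; split_ifs with h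
  · linarith [hy z]
  · linarith

lemma ev_bool_sq {A : Type} [Fintype A] (ν : Fin n → A → ℝ) {h : (Fin n → A) → ℝ}
    (hb : ∀ z, h z = 0 ∨ h z = 1) : ev ν (fun z => h z ^ 2) = ev ν h := by
  congr 1; funext z; rcases hb z with e | e <;> rw [e] <;> norm_num

lemma bool_mem {A : Type} {h : A → ℝ} (hb : ∀ z, h z = 0 ∨ h z = 1) (z : A) :
    h z ∈ Set.Icc (0:ℝ) 1 := by rcases hb z with e | e <;> rw [e] <;> simp

lemma step_gain (hα : 0 < α) (hρ0 : 0 ≤ ρ) (hρ1 : ρ ≤ 1) (hP : ∀ i, Pair α ρ (P i))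
    {q q' : Fin n → ℝ} (hq0 : ∀ i, 0 < q i) (hqq : ∀ i, q i ≤ q' i) (hq1 : ∀ i, q' i ≤ 1)
    (b0 : Fin m) (J : Fin n → Bool)
    (hJ : ∀ i, J i = true → (m : ℝ)⁻¹ ≤ q i * (q' i - q i) / q' i * (1 - ρ))
    (h : (Fin n → X ⊕ Y) → ℝ) (hb : ∀ z, h z = 0 ∨ h z = 1) {ε : ℝ} (hε : 0 ≤ ε) :
    ev (nuF P q) h + Ec (fun c => aS (nuF P q) h (col J {b0} c)) - 2 * ε
      ≤ ev (nuF P q') (thr ε (op (KF P q q') h)) := by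
  have hν' : IsP (nuF P q') := isP_nuF hα hP (fun i => (hq0 i).le.trans (hqq i)) hq1
  have hc := contraction hα hρ0 hρ1 hP hq0 hqq hq1 b0 J hJ h
  rw [ev_bool_sq _ hb] at hc
  have h1 := ev_mono hν'.1 (fun z => le_thr hε (y := op (KF P q q') h) z)
  rw [ev_sub, ev_sub, ev_smul, ev_KF hα hP (fun i => ((hq0 i).trans_le (hqq i)).ne'),
    ev_const hν'.2] at h1
  linarith

lemma step_bound (hα : 0 < α) (hP : ∀ i, Pair α ρ (P i))
    {q q' : Fin n → ℝ} (hq0 : ∀ i, 0 < q i) (hqq : ∀ i, q i ≤ q' i) (hq1 : ∀ i, q' i ≤ 1)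
    (h : (Fin n → X ⊕ Y) → ℝ) (hh : ∀ z, 0 ≤ h z) {ε : ℝ} (z : Fin n → X) :
    ε * op (TF P q') (thr ε (op (KF P q q') h)) z ≤ op (TF P q) h z := by
  have hq0' : ∀ i, 0 < q' i := fun i => (hq0 i).trans_le (hqq i)
  rw [← op_TF_KF (fun i => (hq0' i).ne') h z, ← op_smul]
  refine op_mono (fun i a b => Tq_nonneg hα (hP i) (hq0' i).le (hq1 i) a b) (fun w => ?_) z
  refine thr_mul_le (fun w => ?_) w
  exact Finset.sum_nonneg fun v _ => mul_nonneg (Finset.prod_nonneg fun i _ =>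
    Kq_nonneg hα (hP i) (hq0 i).le (hq0' i) (hqq i) _ _) (hh v)

end step


/-! ### Restrictions and the main induction -/

section core

variable {n m : ℕ} {A : Type} [Fintype A]

lemma ev_update (ν : Fin n → A → ℝ) (i : Fin n) (r : A → ℝ) (G : (Fin n → A) → ℝ) :
    ev (Function.update ν i r) G
      = ∑ z, r (z i) * ((∏ k ∈ Finset.univ.erase i, ν k (z k)) * G z) := by
  unfold ev
  refine Finset.sum_congr rfl fun z _ => ?_
  rw [← Finset.mul_prod_erase Finset.univ _ (Finset.mem_univ i), mul_assoc]
  congr 1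
  · simp
  · congr 1
    refine Finset.prod_congr rfl fun k hk => ?_
    rw [Function.update_of_ne (Finset.ne_of_mem_erase hk)]

lemma prod_dl (z w : Fin n → A) : (∏ i, dl (z i) (w i)) = dl z w := by
  by_cases h : z = w
  · subst h; simp [dl_self]
  · rw [dl_ne h]
    obtain ⟨i, hi⟩ := Function.ne_iff.1 h
    exact Finset.prod_eq_zero (Finset.mem_univ i) (dl_ne hi)

lemma op_upd (i : Fin n) (b : A) (G : (Fin n → A) → ℝ) (z : Fin n → A) :
    op (fun k a c => if k = i then dl b c else dl a c) G z = G (Function.update z i b) := by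
  unfold op
  have : ∀ w : Fin n → A, (∏ k, if k = i then dl b (w k) else dl (z k) (w k))
      = dl (Function.update z i b) w := by
    intro w
    rw [← prod_dl]
    refine Finset.prod_congr rfl fun k _ => ?_
    by_cases hk : k = i
    · subst hk; simp
    · simp [hk]
  simp only [this]
  exact sum_dl_mul _ G

lemma ev_comp_upd {ν : Fin n → A → ℝ} (hν : IsP ν) (i : Fin n) (b : A) (G : (Fin n → A) → ℝ) :
    ev ν (fun z => G (Function.update z i b)) = ev (Function.update ν i (dl b)) G := by
  have : (fun z => G (Function.update z i b))
      = op (fun k a c => if k = i then dl b c else dl a c) G := by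
    funext z; rw [op_upd]
  rw [this, ev_op]
  congr 1
  funext k c
  by_cases hk : k = i
  · subst hk; simp [← Finset.sum_mul, hν.2]
  · simp only [hk, if_false, Function.update_of_ne hk]
    exact sum_mul_dl c _

lemma ev_eq_sum_upd {ν : Fin n → A → ℝ} (hν : IsP ν) (i : Fin n) (G : (Fin n → A) → ℝ) :
    ev ν G = ∑ b, ν i b * ev ν (fun z => G (Function.update z i b)) := by
  simp only [ev_comp_upd hν, ev_update, Finset.mul_sum]
  rw [Finset.sum_comm]
  have : ev ν G = ev (Function.update ν i (ν i)) G := by rw [Function.update_eq_self]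
  rw [this, ev_update]
  refine Finset.sum_congr rfl fun z _ => ?_
  simp only [← mul_assoc, ← Finset.sum_mul]
  rw [sum_mul_dl]

lemma ev_upd_le {ν : Fin n → A → ℝ} (hν : IsP ν) (i : Fin n) {G : (Fin n → A) → ℝ}
    (hG : ∀ z, 0 ≤ G z) (b : A) :
    ν i b * ev ν (fun z => G (Function.update z i b)) ≤ ev ν G := by
  rw [ev_eq_sum_upd hν i G]
  exact Finset.single_le_sum (f := fun b => ν i b * ev ν (fun z => G (Function.update z i b)))
    (fun b _ => mul_nonneg (hν.1 _ _) (ev_nonneg hν.1 fun z => hG _)) (Finset.mem_univ b)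

/-- All restrictions of size at most `k` keep mean at least `μ0`. -/
def LowRes (π : Fin n → A → ℝ) (μ0 : ℝ) : ℕ → ((Fin n → A) → ℝ) → Prop
  | 0, f => μ0 ≤ ev π f
  | k + 1, f => μ0 ≤ ev π f ∧ ∀ i a, LowRes π μ0 k (fun z => f (Function.update z i a))

lemma LowRes.mean {π : Fin n → A → ℝ} {μ0 : ℝ} {k : ℕ} {f : (Fin n → A) → ℝ}
    (h : LowRes π μ0 k f) : μ0 ≤ ev π f := by
  cases k with
  | zero => exact h
  | succ k => exact h.1

lemma LowRes.mono {π : Fin n → A → ℝ} {μ0 : ℝ} : ∀ {k l : ℕ} (_ : l ≤ k) {f : (Fin n → A) → ℝ}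
    (_ : LowRes π μ0 k f), LowRes π μ0 l f := by
  intro k
  induction k with
  | zero => intro l hl f h; rw [Nat.le_zero.1 hl]; exact h
  | succ k ih =>
    intro l hl f h
    cases l with
    | zero => exact h.1
    | succ l => exact ⟨h.1, fun i a => ih (Nat.le_of_succ_le_succ hl) (h.2 i a)⟩

variable {X Y : Type} [Fintype X] [Fintype Y] {α ρ : ℝ} {P : Fin n → X → Y → ℝ}

lemma op_TF_upd (hα : 0 < α) (hP : ∀ i, Pair α ρ (P i)) (q : ℝ) (i : Fin n) (a : X)
    (h : (Fin n → X ⊕ Y) → ℝ) (x : Fin n → X) :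
    op (TF P (Function.update (fun _ => q) i 1)) h (Function.update x i a)
      = op (TF P (fun _ => q)) (fun w => h (Function.update w i (Sum.inl a))) x := by
  have : (fun w => h (Function.update w i (Sum.inl a)))
      = op (fun k v c => if k = i then dl (Sum.inl a) c else dl v c) h := by
    funext z; rw [op_upd]
  rw [this, op_comp]
  unfold op
  refine Finset.sum_congr rfl fun w _ => ?_
  congr 1
  refine Finset.prod_congr rfl fun k _ => ?_
  by_cases hk : k = i
  · subst hk
    simp only [TF, Function.update_self, if_true]
    rw [← Finset.sum_mul, Tq_sum hα (hP k), one_mul]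
    rcases w k with c | c
    · simp only [Tq, Sum.elim_inl, one_mul]
      by_cases hc : a = c
      · subst hc; simp [dl_self]
      · rw [dl_ne hc, dl_ne (fun h => hc (Sum.inl.inj h))]
    · simp only [Tq, Sum.elim_inr, sub_self, zero_mul]
      rw [dl_ne (by simp)]
  · simp only [TF, hk, if_false, Function.update_of_ne hk]
    rw [sum_mul_dl]

lemma exists_best (hα : 0 < α) (hP : ∀ i, Pair α ρ (P i)) {q : ℝ} (hq0 : 0 ≤ q) (hq1 : q ≤ 1)
    (i : Fin n) (h : (Fin n → X ⊕ Y) → ℝ) :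
    ∃ a : X, ev (nuF P (Function.update (fun _ => q) i 1)) h
      ≤ ev (nuF P (fun _ => q)) (fun w => h (Function.update w i (Sum.inl a))) := by
  set q' : Fin n → ℝ := Function.update (fun _ => q) i 1 with hq'
  have hν : IsP (nuF P (fun _ => q)) := isP_nuF hα hP (fun _ => hq0) (fun _ => hq1)
  have hν' : IsP (nuF P q') := isP_nuF hα hP
    (fun k => by by_cases hk : k = i
                 · subst hk; simp [hq']
                 · simpa [hq', hk] using hq0)
    (fun k => by by_cases hk : k = i
                 · subst hk; simp [hq']
                 · simpa [hq', hk] using hq1)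
  have hup : nuF P q' = Function.update (nuF P (fun _ => q)) i (nuq (P i) 1) := by
    funext k
    by_cases hk : k = i
    · subst hk; simp [hq', nuF]
    · simp [hq', nuF, hk]
  have e : ∀ b, ev (nuF P q') (fun z => h (Function.update z i b))
      = ev (nuF P (fun _ => q)) (fun z => h (Function.update z i b)) := by
    intro b
    rw [ev_comp_upd hν', ev_comp_upd hν, hup, Function.update_idem]
  by_contra hcon
  push Not at hcon
  have h1 := ev_eq_sum_upd hν' i h
  rw [Fintype.sum_sum_type] at h1
  have h2 : ∀ y, nuF P q' i (Sum.inr y) = 0 := by intro y; simp [nuF, hq', nuq]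
  have h3 : ∀ x, nuF P q' i (Sum.inl x) = mX (P i) x := by intro y; simp [nuF, hq', nuq]
  simp only [h2, h3, zero_mul, Finset.sum_const_zero, add_zero, e] at h1
  have hs := (hP i).sum_mX
  have hne : (Finset.univ : Finset X).Nonempty := by
    by_contra hemp
    rw [Finset.not_nonempty_iff_eq_empty] at hemp
    rw [hemp] at hs; simp at hs
  have : ∑ x, mX (P i) x * ev (nuF P (fun _ => q)) (fun z => h (Function.update z i (Sum.inl x)))
      < ∑ x, mX (P i) x * ev (nuF P q') h :=
    Finset.sum_lt_sum_of_nonempty hne fun x _ =>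
      mul_lt_mul_of_pos_left (hcon x) ((hP i).mX_pos hα x)
  rw [← Finset.sum_mul, hs, one_mul] at this
  linarith

/-- The finishing case: small variance. -/
lemma finish {π : Fin n → A → ℝ} (hπ : IsP π) {f y : (Fin n → A) → ℝ}
    (hf : ∀ z, f z ∈ Set.Icc (0:ℝ) 1) {μ0 η : ℝ} (hμ : 0 < μ0) (hη : 0 < η) (hfm : μ0 ≤ ev π f)
    (hy : η ≤ ev π y) (hv : ev π (fun z => y z ^ 2) - (ev π y) ^ 2 ≤ (μ0 * η / 2) ^ 2) :
    μ0 * η / 2 ≤ ev π (fun z => f z * y z) := by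
  set θ := ev π y with hθ
  set r := μ0 * η / 2 with hr
  have hr0 : 0 < r := by positivity
  have h1 : ∀ z, θ * f z - ((y z ^ 2 - 2 * θ * y z + θ ^ 2) * (1 / (2 * r)) + r / 2) ≤ f z * y z := by
    intro z
    have hfz := hf z
    have ha : -|y z - θ| ≤ f z * (y z - θ) := by
      have := neg_abs_le (y z - θ)
      have h2 : |f z * (y z - θ)| ≤ |y z - θ| := by
        rw [abs_mul, abs_of_nonneg hfz.1]
        exact mul_le_of_le_one_left (abs_nonneg _) hfz.2
      linarith [neg_abs_le (f z * (y z - θ))]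
    have hb : |y z - θ| ≤ (y z - θ) ^ 2 * (1 / (2 * r)) + r / 2 := by
      have : (y z - θ) ^ 2 * (1 / (2 * r)) + r / 2 - |y z - θ|
          = (|y z - θ| - r) ^ 2 * (1 / (2 * r)) := by
        rw [← sq_abs (y z - θ)]; field_simp; ring
      have h3 : 0 ≤ (|y z - θ| - r) ^ 2 * (1 / (2 * r)) := by positivity
      linarith
    have hc : (y z - θ) ^ 2 = y z ^ 2 - 2 * θ * y z + θ ^ 2 := by ring
    rw [hc] at hb
    nlinarith
  have h2 := ev_mono hπ.1 h1
  have h3 : ev π (fun z => θ * f z - ((y z ^ 2 - 2 * θ * y z + θ ^ 2) * (1 / (2 * r)) + r / 2))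
      = θ * ev π f - ((ev π (fun z => y z ^ 2) - 2 * θ * θ + θ ^ 2) * (1 / (2 * r)) + r / 2) := by
    rw [ev_sub, ev_smul, ev_add, ev_const hπ.2]
    congr 2
    have : (fun z => (y z ^ 2 - 2 * θ * y z + θ ^ 2) * (1 / (2 * r)))
        = fun z => (1 / (2 * r)) * (y z ^ 2 - 2 * θ * y z + θ ^ 2) := by funext z; ring
    rw [this, ev_smul, ev_add, ev_sub, ev_smul, ev_const hπ.2, ← hθ]
    ring
  rw [h3] at h2
  have h4 : (ev π (fun z => y z ^ 2) - 2 * θ * θ + θ ^ 2) * (1 / (2 * r)) ≤ r / 2 := by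
    have : ev π (fun z => y z ^ 2) - 2 * θ * θ + θ ^ 2 ≤ r ^ 2 := by nlinarith
    calc _ ≤ r ^ 2 * (1 / (2 * r)) := mul_le_mul_of_nonneg_right this (by positivity)
      _ = r / 2 := by field_simp
  have h5 : μ0 * η ≤ θ * ev π f := by
    rw [mul_comm]; exact mul_le_mul hy hfm hμ.le (hη.le.trans hy)
  linarith

lemma core (hα : 0 < α) (hρ0 : 0 ≤ ρ) (hρ1 : ρ < 1) (hP : ∀ i, Pair α ρ (P i))
    {μ0 η τ τ1 κ : ℝ} {N B : ℕ} (hμ : 0 < μ0) (hη : 0 < η) (hN : 0 < N) (b0 : Fin m)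
    (hmN : (m : ℝ)⁻¹ ≤ (1 - ρ) / (4 * N)) (hτ : 0 < τ) (hτ1 : τ1 = τ / (2 * m))
    (hB : 1 ≤ B * τ1) (hκ0 : 0 < κ) (hκ1 : κ ≤ 1) (hκN : κ ≤ 1 / (2 * N))
    (hκτ : κ ≤ α * (τ / (4 * m)))
    (hD : ∀ q : ℝ, 0 ≤ q → q ≤ 1 → ∀ h : (Fin n → X ⊕ Y) → ℝ, (∀ z, h z = 0 ∨ h z = 1) →
      ev (pX P) (fun z => op (TF P (fun _ => q)) h z ^ 2)
          - (ev (pX P) (op (TF P (fun _ => q)) h)) ^ 2 ≤ (μ0 * η / 2) ^ 2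
      ∨ (∃ i, τ ≤ aS (nuF P (fun _ => q)) h (sgl i))
      ∨ 2 / N ≤ Ec (fun c => aS (nuF P (fun _ => q)) h (cl b0 c))) :
    ∀ s r b : ℕ, r + b = s → r ≤ N → b ≤ B → ∀ (f : (Fin n → X) → ℝ) (h : (Fin n → X ⊕ Y) → ℝ),
      (∀ z, f z ∈ Set.Icc (0:ℝ) 1) → LowRes (pX P) μ0 b f → (∀ z, h z = 0 ∨ h z = 1) →
      η + ((N : ℝ) - r) / N + ((B : ℝ) - b) * τ1 ≤ ev (nuF P (fun _ => 1 - (r : ℝ) / (2 * N))) h →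
      κ ^ s * (μ0 * η / 2)
        ≤ ev (pX P) (fun x => f x * op (TF P (fun _ => 1 - (r : ℝ) / (2 * N))) h x) := by
  have hNr : (0:ℝ) < N := by exact_mod_cast hN
  have hm : 0 < m := b0.pos
  have hmr : (0:ℝ) < m := by exact_mod_cast hm
  have hτ1' : 0 < τ1 := by rw [hτ1]; positivity
  have hπ := isP_pX hα hP
  have hr0 : 0 < μ0 * η / 2 := by positivity
  intro s
  induction s with
  | zero =>
    intro r b hrb hr hb f h hf hL hb' hmean
    exfalso
    have hr0' : r = 0 := by omega
    have hb0 : b = 0 := by omega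
    subst hr0' hb0
    have hν : IsP (nuF P (fun _ => 1 - ((0:ℕ) : ℝ) / (2 * N))) :=
      isP_nuF hα hP (fun _ => by simp) (fun _ => by simp)
    have h1 := ev_mono hν.1 (fun z => (bool_mem hb' z).2)
    rw [ev_const hν.2] at h1
    have : ((N : ℝ) - ((0:ℕ) : ℝ)) / N = 1 := by simp [hNr.ne']
    rw [this] at hmean
    push_cast at hmean
    have : 0 ≤ (B:ℝ) * τ1 := by positivity
    push_cast at h1
    linarith
  | succ s ih =>
    intro r b hrb hr hb f h hf hL hb' hmean
    have hrr : (r : ℝ) ≤ N := by exact_mod_cast hr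
    have hbB : (b : ℝ) ≤ B := by exact_mod_cast hb
    set q : ℝ := 1 - (r : ℝ) / (2 * N) with hq
    have hqh : 1 / 2 ≤ q := by
      have : (r : ℝ) / (2 * N) ≤ 1 / 2 := by rw [div_le_div_iff₀ (by positivity) (by positivity)]; linarith
      rw [hq]; linarith
    have hq1 : q ≤ 1 := by
      have : 0 ≤ (r : ℝ) / (2 * N) := by positivity
      rw [hq]; linarith
    have hq0 : 0 < q := by linarith
    have hν : IsP (nuF P (fun _ => q)) := isP_nuF hα hP (fun _ => hq0.le) (fun _ => hq1)
    have hle1 : ev (nuF P (fun _ => q)) h ≤ 1 := by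
      have h1 := ev_mono hν.1 (fun z => (bool_mem hb' z).2)
      rwa [ev_const hν.2] at h1
    have hx0 : 0 ≤ ((N : ℝ) - r) / N := div_nonneg (by linarith) hNr.le
    have hx1 : 0 ≤ ((B : ℝ) - b) * τ1 := mul_nonneg (by linarith) hτ1'.le
    have hrpos : 0 < r := by
      rcases Nat.eq_zero_or_pos r with h0 | h0
      · exfalso
        subst h0
        have : ((N : ℝ) - ((0:ℕ) : ℝ)) / N = 1 := by simp [hNr.ne']
        rw [this] at hmean
        linarith
      · exact h0
    have hbpos : 0 < b := by
      rcases Nat.eq_zero_or_pos b with h0 | h0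
      · exfalso
        subst h0
        push_cast at hmean
        linarith
      · exact h0
    have hr1 : (1:ℝ) ≤ r := by exact_mod_cast hrpos
    have hT0 : ∀ i a w, 0 ≤ TF P (fun _ => q) i a w := fun i a w =>
      Tq_nonneg hα (hP i) hq0.le hq1 a w
    rcases hD q hq0.le hq1 h hb' with hA | ⟨i, hi⟩ | hC
    · have hy : η ≤ ev (pX P) (op (TF P (fun _ => q)) h) := by
        rw [ev_TF hα hP]; linarith
      have := finish hπ hf hμ hη hL.mean hy hA
      refine le_trans ?_ this
      exact mul_le_of_le_one_left hr0.le (pow_le_one₀ hκ0.le hκ1)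
    · -- junk step
      obtain ⟨b, rfl⟩ : ∃ b', b = b' + 1 := ⟨b - 1, by omega⟩
      set q' : Fin n → ℝ := Function.update (fun _ => q) i 1 with hq'
      have hqq : ∀ k, (fun _ : Fin n => q) k ≤ q' k := by
        intro k; by_cases hk : k = i
        · subst hk; simpa [hq'] using hq1
        · simp [hq', hk]
      have hq'1 : ∀ k, q' k ≤ 1 := by
        intro k; by_cases hk : k = i
        · subst hk; simp [hq']
        · simpa [hq', hk] using hq1
      have hq'0 : ∀ k, 0 ≤ q' k := fun k => hq0.le.trans (hqq k)
      have hε : 0 ≤ τ / (4 * m) := by positivity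
      set h' := thr (τ / (4 * m)) (op (KF P (fun _ => q) q') h) with hh'
      have hG := step_gain hα hρ0 hρ1.le hP (q := fun _ => q) (q' := q') (fun _ => hq0) hqq hq'1 b0
        (sgl i) (by
          intro k hk
          have hk' : k = i := by simpa [sgl] using hk
          subst hk'
          simp only [hq', Function.update_self, div_one]
          refine hmN.trans ?_
          have h1 : 1 / (2 * N) ≤ 1 - q := by
            rw [hq, sub_sub_cancel]
            exact div_le_div_of_nonneg_right hr1 (by positivity)
          have h2 : 1 / (4 * (N:ℝ)) ≤ q * (1 - q) := by
            have : 1 / (4 * (N:ℝ)) = 1 / 2 * (1 / (2 * N)) := by field_simp; norm_num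
            rw [this]
            exact mul_le_mul hqh h1 (by positivity) hq0.le
          calc (1 - ρ) / (4 * N) = 1 / (4 * (N:ℝ)) * (1 - ρ) := by ring
            _ ≤ _ := mul_le_mul_of_nonneg_right h2 (by linarith))
        h hb' hε
      have hG2 := Ec_col_ge (a := aS (nuF P (fun _ => q)) h) (aS_bot _) (aS_sup hν h) (sgl i) b0
      obtain ⟨a, ha⟩ := exists_best hα hP hq0.le hq1 i h'
      have hgain : ev (nuF P (fun _ => q)) h + τ1
          ≤ ev (nuF P (fun _ => q)) (fun w => h' (Function.update w i (Sum.inl a))) := by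
        refine le_trans ?_ ha
        refine le_trans ?_ hG
        have : τ / m ≤ aS (nuF P (fun _ => q)) h (sgl i) / m :=
          div_le_div_of_nonneg_right hi hmr.le
        have e2 : τ / m - 2 * (τ / (4 * m)) = τ1 := by rw [hτ1]; field_simp; norm_num
        linarith
      have I := ih r b (by omega) hr (by omega) (fun x => f (Function.update x i a))
        (fun w => h' (Function.update w i (Sum.inl a))) (fun z => hf _) (hL.2 i a)
        (fun z => thr_bool _ _ _) (by
          refine le_trans ?_ hgain
          push_cast at hmean ⊢
          linarith)
      have hTnn : ∀ x, 0 ≤ op (TF P q') h' x := fun x =>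
        Finset.sum_nonneg fun v _ => mul_nonneg (Finset.prod_nonneg fun k _ =>
          Tq_nonneg hα (hP k) (hq'0 k) (hq'1 k) _ _) (bool_mem (thr_bool _ _) v).1
      have hu := ev_upd_le hπ i (G := fun x => f x * op (TF P q') h' x)
        (fun z => mul_nonneg (hf z).1 (hTnn z)) a
      have hsim : ev (pX P) (fun z => (fun x => f x * op (TF P q') h' x) (Function.update z i a))
          = ev (pX P) (fun x => f (Function.update x i a)
            * op (TF P (fun _ => q)) (fun w => h' (Function.update w i (Sum.inl a))) x) := by
        congr 1; funext z
        simp only [hq']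
        rw [op_TF_upd hα hP]
      rw [hsim] at hu
      set E1 := ev (pX P) (fun x => f (Function.update x i a)
            * op (TF P (fun _ => q)) (fun w => h' (Function.update w i (Sum.inl a))) x) with hE1
      have hE10 : 0 ≤ E1 := le_trans (by positivity) I
      have hfin : τ / (4 * m) * ev (pX P) (fun x => f x * op (TF P q') h' x)
          ≤ ev (pX P) (fun x => f x * op (TF P (fun _ => q)) h x) := by
        rw [← ev_smul]
        refine ev_mono hπ.1 fun x => ?_
        have := step_bound hα hP (q := fun _ => q) (q' := q') (fun _ => hq0) hqq hq'1 h
          (fun z => (bool_mem hb' z).1) (ε := τ / (4 * m)) x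
        have := mul_le_mul_of_nonneg_left this (hf x).1
        linarith
      refine le_trans ?_ hfin
      have h1 : α * E1 ≤ ev (pX P) (fun x => f x * op (TF P q') h' x) :=
        le_trans (mul_le_mul_of_nonneg_right ((hP i).lb a) hE10) hu
      have h2 := mul_le_mul_of_nonneg_left h1 hε
      refine le_trans ?_ h2
      calc κ ^ (s + 1) * (μ0 * η / 2) = κ * (κ ^ s * (μ0 * η / 2)) := by ring
        _ ≤ κ * E1 := mul_le_mul_of_nonneg_left I hκ0.le
        _ ≤ α * (τ / (4 * m)) * E1 := mul_le_mul_of_nonneg_right hκτ hE10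
        _ = _ := by ring
    · -- chain step
      obtain ⟨r, rfl⟩ : ∃ r', r = r' + 1 := ⟨r - 1, by omega⟩
      set q' : ℝ := 1 - (r : ℝ) / (2 * N) with hq'
      have hdq : q' - q = 1 / (2 * N) := by rw [hq, hq']; push_cast; ring
      have hqq : q ≤ q' := by
        have : (0:ℝ) < 1 / (2 * N) := by positivity
        linarith
      have hq'1 : q' ≤ 1 := by
        have : 0 ≤ (r : ℝ) / (2 * N) := by positivity
        rw [hq']; linarith
      have hq'0 : 0 < q' := hq0.trans_le hqq
      have hε : 0 ≤ 1 / (2 * (N:ℝ)) := by positivity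
      set h' := thr (1 / (2 * (N:ℝ))) (op (KF P (fun _ => q) (fun _ => q')) h) with hh'
      have hG := step_gain hα hρ0 hρ1.le hP (q := fun _ => q) (q' := fun _ => q') (fun _ => hq0)
        (fun _ => hqq) (fun _ => hq'1) b0 (fun _ => true) (by
          intro k _
          refine hmN.trans ?_
          rw [hdq]
          have h2 : 1 / (4 * (N:ℝ)) ≤ q * (1 / (2 * N)) / q' := by
            rw [le_div_iff₀ hq'0]
            calc 1 / (4 * (N:ℝ)) * q' ≤ 1 / (4 * (N:ℝ)) * 1 :=
                  mul_le_mul_of_nonneg_left hq'1 (by positivity)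
              _ = 1 / 2 * (1 / (2 * N)) := by field_simp; norm_num
              _ ≤ _ := mul_le_mul_of_nonneg_right hqh hε
          calc (1 - ρ) / (4 * N) = 1 / (4 * (N:ℝ)) * (1 - ρ) := by ring
            _ ≤ _ := mul_le_mul_of_nonneg_right h2 (by linarith))
        h hb' hε
      simp only [cl_eq_col] at hG
      have I := ih r b (by omega) (by omega) hb f h' hf hL (fun z => thr_bool _ _ _) (by
        refine le_trans ?_ hG
        have e1 : ((N:ℝ) - r) / N = ((N:ℝ) - ((r + 1 : ℕ) : ℝ)) / N + 1 / N := by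
          push_cast; field_simp; ring
        have e2 : 2 / (N:ℝ) - 2 * (1 / (2 * N)) = 1 / N := by field_simp; norm_num
        rw [e1]
        linarith)
      have hfin : 1 / (2 * (N:ℝ)) * ev (pX P) (fun x => f x * op (TF P (fun _ => q')) h' x)
          ≤ ev (pX P) (fun x => f x * op (TF P (fun _ => q)) h x) := by
        rw [← ev_smul]
        refine ev_mono hπ.1 fun x => ?_
        have := step_bound hα hP (q := fun _ => q) (q' := fun _ => q') (fun _ => hq0)
          (fun _ => hqq) (fun _ => hq'1) h
          (fun z => (bool_mem hb' z).1) (ε := 1 / (2 * (N:ℝ))) x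
        have := mul_le_mul_of_nonneg_left this (hf x).1
        linarith
      refine le_trans ?_ hfin
      calc κ ^ (s + 1) * (μ0 * η / 2) = κ * (κ ^ s * (μ0 * η / 2)) := by ring
        _ ≤ 1 / (2 * (N:ℝ)) * (κ ^ s * (μ0 * η / 2)) :=
          mul_le_mul_of_nonneg_right hκN (by positivity)
        _ ≤ _ := mul_le_mul_of_nonneg_left I hε

end core

/-! ### Choice of constants -/

section constants

set_option maxHeartbeats 1000000 in
lemma num_consts {α ρ v : ℝ} (hα : 0 < α) (hρ0 : 0 ≤ ρ) (hρ1 : ρ < 1) (hv : 0 < v) :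
    ∃ (N m k : ℕ) (τ e lam : ℝ), 0 < N ∧ 0 < m ∧ k ≤ m ∧ 0 < τ ∧ 0 < lam ∧ 0 ≤ e ∧ e < 1 ∧
      (k : ℝ) / m < 1 ∧ e * (1 + α) = (k : ℝ) / m * α ∧
      (m : ℝ)⁻¹ ≤ (1 - ρ) / (4 * N) ∧
      ∀ D V : ℝ, v < D → 0 ≤ V → V < 2 / N →
        (D - k * V) / m ≤ 2 * lam ^ (e / (2 - e)) * V + 8 * lam ^ (e / (2 - e) - 1) * V * (τ + V)
        → False := by
  have h1ρ : 0 < 1 - ρ := by linarith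
  obtain ⟨M0, hM0⟩ := exists_nat_ge (4 / (1 - ρ))
  have hM0p : (0:ℝ) < M0 := lt_of_lt_of_le (by positivity) hM0
  set K : ℝ := 2 * M0 with hK
  have hKp : 0 < K := by positivity
  obtain ⟨J0, hJ0⟩ := exists_nat_ge (max 2 (2 * K / v))
  have hJ2 : (2:ℝ) ≤ J0 := (le_max_left _ _).trans hJ0
  have hJv : 2 * K / v ≤ J0 := (le_max_right _ _).trans hJ0
  have hJp : (0:ℝ) < J0 := by linarith
  set e : ℝ := 1 / J0 * α / (1 + α) with he
  have he0 : 0 < e := by positivity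
  have heq : e * (1 + α) = 1 / J0 * α := by rw [he]; field_simp
  have hs : (1:ℝ) / J0 ≤ 1 / 2 := one_div_le_one_div_of_le (by norm_num) hJ2
  have he1 : e < 1 := by nlinarith
  set e' : ℝ := e / (2 - e) with he'
  have he'0 : 0 < e' := div_pos he0 (by linarith)
  set lam : ℝ := (v / (16 * K)) ^ (1 / e') with hlam
  have hlam0 : 0 < lam := Real.rpow_pos_of_pos (by positivity) _
  have hlame : lam ^ e' = v / (16 * K) := by
    rw [hlam, ← Real.rpow_mul (by positivity), one_div_mul_cancel he'0.ne', Real.rpow_one]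
  set G : ℝ := lam ^ (e' - 1) with hG
  have hG0 : 0 < G := Real.rpow_pos_of_pos hlam0 _
  set τ : ℝ := v / (64 * K * G) with hτ
  have hτ0 : 0 < τ := by positivity
  obtain ⟨N1, hN1⟩ := exists_nat_ge (2 / τ)
  have hN1p : (0:ℝ) < N1 := lt_of_lt_of_le (by positivity) hN1
  have hJn : 0 < J0 := by exact_mod_cast hJp
  have hNn : 0 < N1 := by exact_mod_cast hN1p
  have hMn : 0 < M0 := by exact_mod_cast hM0p
  have hkm : ((N1 * M0 : ℕ) : ℝ) / ((J0 * N1 * M0 : ℕ) : ℝ) = 1 / J0 := by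
    push_cast; field_simp
  refine ⟨J0 * N1, J0 * N1 * M0, N1 * M0, τ, e, lam, by positivity, by positivity, ?_, hτ0, hlam0,
    he0.le, he1, ?_, ?_, ?_, ?_⟩
  · rw [mul_assoc]; exact Nat.le_mul_of_pos_left _ hJn
  · rw [hkm]; linarith
  · rw [hkm, heq]
  · have h4 : 4 ≤ M0 * (1 - ρ) := by rwa [div_le_iff₀ h1ρ] at hM0
    push_cast
    rw [inv_eq_one_div, div_le_div_iff₀ (by positivity) (by positivity)]
    nlinarith [mul_pos hJp hN1p]
  · intro D V hD hV0 hV hle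
    rw [← he', hlame, ← hG] at hle
    set m : ℝ := ((J0 * N1 * M0 : ℕ) : ℝ) with hm
    have hme : m = J0 * N1 * M0 := by rw [hm]; push_cast; ring
    have hmp : 0 < m := by rw [hme]; positivity
    have hVm : m * V ≤ K := by
      have : m * V ≤ m * (2 / ((J0 * N1 : ℕ) : ℝ)) := mul_le_mul_of_nonneg_left hV.le hmp.le
      refine this.trans (le_of_eq ?_)
      rw [hme, hK]; push_cast; field_simp
    have hVτ : V ≤ τ := by
      refine hV.le.trans ?_
      push_cast
      rw [div_le_iff₀ (by positivity)]
      have : 2 ≤ N1 * τ := by rwa [div_le_iff₀ hτ0] at hN1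
      nlinarith [mul_pos hτ0 hN1p]
    have hk : ((N1 * M0 : ℕ) : ℝ) * V ≤ v / 2 := by
      have e1 : ((N1 * M0 : ℕ) : ℝ) * V = m * V / J0 := by
        rw [hme]; push_cast; field_simp
      rw [e1, div_le_iff₀ hJp]
      rw [div_le_iff₀ hv] at hJv
      nlinarith
    rw [div_le_iff₀ hmp] at hle
    have hb : (2 * (v / (16 * K)) * V + 8 * G * V * (τ + V)) * m
        ≤ (2 * (v / (16 * K)) + 16 * G * τ) * K := by
      have : (2 * (v / (16 * K)) * V + 8 * G * V * (τ + V)) * m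
        = (2 * (v / (16 * K)) + 8 * G * (τ + V)) * (m * V) := by ring
      rw [this]
      refine mul_le_mul ?_ hVm (by positivity) (by positivity)
      have h8 : 8 * G * (τ + V) ≤ 8 * G * (τ + τ) :=
        mul_le_mul_of_nonneg_left (by linarith) (by positivity)
      linarith
    have hc : (2 * (v / (16 * K)) + 16 * G * τ) * K = 3 / 8 * v := by
      rw [hτ]; field_simp; norm_num
    linarith

end constants

/-! ### The two-function hitting lemma -/

section lemmaA

lemma hitting {α ρ μ0 η' : ℝ} (hα : 0 < α) (hρ0 : 0 ≤ ρ) (hρ1 : ρ < 1) (hμ : 0 < μ0)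
    (hη' : 0 < η') : ∃ (B : ℕ) (ε : ℝ), 0 < ε ∧ ∀ (n : ℕ) (X Y : Type) [Fintype X] [Fintype Y]
      (P : Fin n → X → Y → ℝ), (∀ i, Pair α ρ (P i)) →
      ∀ (f : (Fin n → X) → ℝ) (g : (Fin n → Y) → ℝ), (∀ z, f z ∈ Set.Icc (0:ℝ) 1) →
      (∀ z, g z ∈ Set.Icc (0:ℝ) 1) → LowRes (pX P) μ0 B f → η' ≤ ev (fun i => mY (P i)) g →
      ε ≤ ev (pX P) (fun x => f x * op (fun i => Cc (P i)) g x) := by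
  set η := η' / 2 with hηd
  have hη : 0 < η := by positivity
  obtain ⟨N, m, k, τ, e, lam, hN, hm, hkm, hτ, hlam, he0, he1, hk1, he, hmN, hcon⟩ :=
    num_consts (v := (μ0 * η / 2) ^ 2) hα hρ0 hρ1 (by positivity)
  have hNr : (0:ℝ) < N := by exact_mod_cast hN
  have hmr : (0:ℝ) < m := by exact_mod_cast hm
  set τ1 := τ / (2 * m) with hτ1
  have hτpos : 0 < τ1 := by positivity
  obtain ⟨B, hB⟩ := exists_nat_ge (1 / τ1)
  have hB' : 1 ≤ B * τ1 := by rwa [div_le_iff₀ hτpos] at hB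
  set κ : ℝ := min 1 (min (1 / (2 * N)) (α * (τ / (4 * m)))) with hκ
  have hκ0 : 0 < κ := by
    rw [hκ]; refine lt_min one_pos (lt_min (by positivity) (by positivity))
  refine ⟨B, η * (κ ^ (N + B) * (μ0 * η / 2)), by positivity, ?_⟩
  intro n X Y _ _ P hP f g hf hg hres hmean
  obtain ⟨sC, -, hsC⟩ := Finset.exists_subset_card_eq
    (s := (Finset.univ : Finset (Fin m))) (n := k) (by simpa using hkm)
  have hcore := core (n := n) (P := P) hα hρ0 hρ1 hP (B := B) hμ hη hN (⟨0, hm⟩ : Fin m) hmN hτ hτ1 hB'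
    hκ0 (min_le_left _ _) ((min_le_right _ _).trans (min_le_left _ _))
    ((min_le_right _ _).trans (min_le_right _ _)) (by
      intro q hq0 hq1 h hb
      by_contra hneg
      push Not at hneg
      obtain ⟨hD, hinf, hV⟩ := hneg
      have hνP : IsP (nuF P (fun _ => q)) := isP_nuF hα hP (fun _ => hq0) (fun _ => hq1)
      refine hcon _ _ hD ?_ hV ?_
      · exact ev_nonneg (fun _ _ => by positivity) fun c => aS_nonneg hνP _ _
      · have := kkl hα sC (⟨0, hm⟩ : Fin m) (by rw [hsC]; exact hk1) (by rw [hsC]; exact he) he0 he1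
          hlam hτ.le (pX P) (fun i x => (hP i).lb x) (isP_pX hα hP).2 (TF P (fun _ => q))
          (fun i a b => Tq_nonneg hα (hP i) hq0 hq1 a b) (fun i a => Tq_sum hα (hP i) _ a)
          (nuF P (fun _ => q)) (fun i b => push_Tq hα (hP i) _ b) h hb (fun i => (hinf i).le) _ rfl
        rw [hsC] at this
        exact this)
  set K0 : Fin n → X ⊕ Y → Y → ℝ := fun i => Sum.elim (Cc (P i)) dl with hK0
  have hK0n : ∀ i a b, 0 ≤ K0 i a b := by
    intro i a b
    rcases a with a | a
    · exact (hP i).Cc_nonneg hα _ _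
    · exact dl_nonneg _ _
  have hK01 : ∀ i a, ∑ b, K0 i a b = 1 := by
    intro i a
    rcases a with a | a
    · exact (hP i).Cc_sum hα _
    · exact sum_dl _
  set q : ℝ := 1 - (N:ℝ) / (2 * N) with hq
  have hqe : q = 1 / 2 := by rw [hq]; field_simp; norm_num
  have hTK : ∀ x, op (TF P (fun _ => q)) (op K0 g) x = op (fun i => Cc (P i)) g x := by
    intro x
    rw [op_comp]
    congr 1
    funext i a c
    rw [Fintype.sum_sum_type]
    simp only [TF, Tq, hK0, Sum.elim_inl, Sum.elim_inr, mul_assoc, ← Finset.mul_sum]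
    rw [sum_dl_mul, sum_mul_dl]; ring
  have hνP : IsP (nuF P (fun _ => q)) :=
    isP_nuF hα hP (fun _ => by rw [hqe]; norm_num) (fun _ => by rw [hqe]; norm_num)
  have hνK : ev (nuF P (fun _ => q)) (op K0 g) = ev (fun i => mY (P i)) g := by
    rw [← ev_TF hα hP]
    have : op (TF P (fun _ => q)) (op K0 g) = op (fun i => Cc (P i)) g := funext hTK
    rw [this, ev_op]
    congr 1
    funext i c
    simp only [pX, mY]
    exact Finset.sum_congr rfl fun x _ => (hP i).mX_Cc hα x c
  have hmem := op_mem hK0n hK01 hg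
  have h1 := hcore (N + B) N B rfl le_rfl le_rfl f (thr η (op K0 g)) hf hres (thr_bool _ _) (by
    have : ev (nuF P (fun _ => q)) (op K0 g) - η ≤ ev (nuF P (fun _ => q)) (thr η (op K0 g)) := by
      rw [← ev_const hνP.2 η, ← ev_sub]
      refine ev_mono hνP.1 fun z => ?_
      rw [ev_const hνP.2 η]
      exact le_thr' hη.le (fun z => (hmem z).2) z
    rw [hνK] at this
    simp only [sub_self, zero_div, zero_mul, add_zero]
    rw [← hq]
    linarith)
  calc η * (κ ^ (N + B) * (μ0 * η / 2))
      ≤ η * ev (pX P) (fun x => f x * op (TF P (fun _ => q)) (thr η (op K0 g)) x) :=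
        mul_le_mul_of_nonneg_left h1 hη.le
    _ = ev (pX P) (fun x => f x * op (TF P (fun _ => q)) (fun z => η * thr η (op K0 g) z) x) := by
        rw [← ev_smul]; congr 1; funext x; rw [op_smul]; ring
    _ ≤ _ := by
        refine ev_mono (isP_pX hα hP).1 fun x => mul_le_mul_of_nonneg_left ?_ (hf x).1
        rw [← hTK]
        refine op_mono (fun i a b => Tq_nonneg hα (hP i) (by rw [hqe]; norm_num)
          (by rw [hqe]; norm_num) a b) (fun z => ?_) x
        exact thr_mul_le (fun z => (hmem z).1) z

end lemmaA

/-! ### Correlation bounds -/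

section correlation

variable {Ω : Type} [Fintype Ω] {ℓ : ℕ} {Q : (Fin ℓ → Ω) → ℝ}

lemma sum_ins (j : Fin ℓ) (F : (Fin ℓ → Ω) → ℝ) :
    ∑ z, F z = ∑ x, ∑ y, F (ins j y x) := by
  rw [← (Equiv.funSplitAt j Ω).symm.sum_comp, Fintype.sum_prod_type]
  refine Finset.sum_congr rfl fun x _ => Finset.sum_congr rfl fun y _ => ?_
  congr 1
  funext k
  by_cases h : k = j
  · subst h; simp [ins, Equiv.funSplitAt]
  · simp [ins, Equiv.funSplitAt, h]

lemma varP_comb (hQ : IsDist Q) (a b : ℝ) (F G : (Fin ℓ → Ω) → ℝ) :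
    0 ≤ a ^ 2 * varP Q F + 2 * (a * b) * covP Q F G + b ^ 2 * varP Q G := by
  have h := jensen_sq Q hQ.1 hQ.2 (fun z => a * F z + b * G z)
  have e1 : ∑ z, Q z * (a * F z + b * G z) = a * expP Q F + b * expP Q G := by
    simp only [expP, Finset.mul_sum, ← Finset.sum_add_distrib]
    exact Finset.sum_congr rfl fun z _ => by ring
  have e2 : ∑ z, Q z * (a * F z + b * G z) ^ 2 = a ^ 2 * expP Q (fun z => F z * F z)
      + 2 * (a * b) * expP Q (fun z => F z * G z) + b ^ 2 * expP Q (fun z => G z * G z) := by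
    simp only [expP, Finset.mul_sum, ← Finset.sum_add_distrib]
    exact Finset.sum_congr rfl fun z _ => by ring
  rw [e1, e2] at h
  unfold varP covP
  nlinarith

lemma expP_smul (a : ℝ) (F : (Fin ℓ → Ω) → ℝ) : expP Q (fun z => a * F z) = a * expP Q F := by
  simp only [expP, Finset.mul_sum]
  exact Finset.sum_congr rfl fun z _ => by ring

lemma covP_smul (a b : ℝ) (F G : (Fin ℓ → Ω) → ℝ) :
    covP Q (fun z => a * F z) (fun z => b * G z) = a * b * covP Q F G := by
  unfold covP
  have : (fun z => a * F z * (b * G z)) = fun z => (a * b) * (F z * G z) := by funext z; ring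
  rw [this, expP_smul, expP_smul, expP_smul]; ring

lemma cov_nonpos_of {c v : ℝ} (h : ∀ t : ℝ, 0 ≤ 2 * t * c + v) : c ≤ 0 := by
  by_contra hc
  push Not at hc
  have := h (-(v + 1) / (2 * c))
  have e : 2 * (-(v + 1) / (2 * c)) * c = -(v + 1) := by field_simp
  rw [e] at this; linarith

lemma cov_le (hQ : IsDist Q) {ρ : ℝ} (hρ0 : 0 ≤ ρ) (hr : rho Q ≤ ρ) (j : Fin ℓ)
    {F G : (Fin ℓ → Ω) → ℝ} (hF : DependsOn F {j}) (hG : DependsOn G {j}ᶜ) :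
    2 * covP Q F G ≤ ρ * (varP Q F + varP Q G) := by
  have vF : 0 ≤ varP Q F := by simpa using varP_comb hQ 1 0 F G
  have vG : 0 ≤ varP Q G := by simpa using varP_comb hQ 0 1 F G
  have hrhs : 0 ≤ ρ * (varP Q F + varP Q G) := mul_nonneg hρ0 (add_nonneg vF vG)
  rcases vF.eq_or_lt with h0 | h0
  · have : covP Q F G ≤ 0 := cov_nonpos_of (v := varP Q G) fun t => by
      have := varP_comb hQ t 1 F G
      rw [← h0] at this; linarith
    linarith
  rcases vG.eq_or_lt with h1 | h1
  · have : covP Q F G ≤ 0 := cov_nonpos_of (v := varP Q F) fun t => by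
      have := varP_comb hQ 1 t F G
      rw [← h1] at this; linarith
    linarith
  have sF := Real.sqrt_pos.2 h0
  have sG := Real.sqrt_pos.2 h1
  have qF := Real.sq_sqrt vF
  have qG := Real.sq_sqrt vG
  have hle : (Real.sqrt (varP Q F))⁻¹ * (Real.sqrt (varP Q G))⁻¹ * covP Q F G ≤ ρ := by
    refine le_trans ?_ hr
    refine le_trans ?_ (le_ciSup (f := fun j : Fin ℓ => rhoST Q {j} ({j}ᶜ))
      (Set.finite_range _).bddAbove j)
    refine le_csSup ⟨1, ?_⟩ ?_
    · rintro r ⟨f, g, -, -, hf, hg, rfl⟩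
      have := varP_comb hQ 1 (-1) f g
      rw [hf, hg] at this; linarith
    · refine ⟨fun z => (Real.sqrt (varP Q F))⁻¹ * F z, fun z => (Real.sqrt (varP Q G))⁻¹ * G z,
        ?_, ?_, ?_, ?_, ?_⟩
      · intro x y h; simp only [hF x y h]
      · intro x y h; simp only [hG x y h]
      · unfold varP; rw [covP_smul, ← varP, ← mul_inv, ← sq, qF]; exact inv_mul_cancel₀ h0.ne'
      · unfold varP; rw [covP_smul, ← varP, ← mul_inv, ← sq, qG]; exact inv_mul_cancel₀ h1.ne'
      · rw [covP_smul]
  have hc : covP Q F G ≤ ρ * (Real.sqrt (varP Q F) * Real.sqrt (varP Q G)) := by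
    rw [← mul_inv, inv_mul_le_iff₀ (mul_pos sF sG)] at hle
    linarith
  have h2 : 2 * (Real.sqrt (varP Q F) * Real.sqrt (varP Q G)) ≤ varP Q F + varP Q G := by
    nlinarith [sq_nonneg (Real.sqrt (varP Q F) - Real.sqrt (varP Q G))]
  nlinarith [mul_le_mul_of_nonneg_left h2 hρ0]

/-- The law of step `j` together with the other steps. -/
def split (Q : (Fin ℓ → Ω) → ℝ) (j : Fin ℓ) (x : Ω) (y : {k : Fin ℓ // k ≠ j} → Ω) : ℝ :=
  Q (ins j y x)

lemma ins_self (j : Fin ℓ) (y : {k : Fin ℓ // k ≠ j} → Ω) (x : Ω) : ins j y x j = x := by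
  simp [ins]

lemma ins_ne (j : Fin ℓ) (y : {k : Fin ℓ // k ≠ j} → Ω) (x : Ω) (k : Fin ℓ) (hk : k ≠ j) :
    ins j y x k = y ⟨k, hk⟩ := by
  simp [ins, hk]

lemma mX_split (j : Fin ℓ) (x : Ω) : mX (split Q j) x = marginal Q j x := by
  classical
  unfold marginal mX split
  rw [sum_ins j]
  simp only [ins_self]
  rw [Finset.sum_eq_single x]
  · simp
  · intro b _ hb; simp [hb]
  · simp

lemma pair_split (hQ : IsDist Q) {α ρ : ℝ} (hρ0 : 0 ≤ ρ) (hr : rho Q ≤ ρ)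
    (hlb : ∀ a, α ≤ Q (fun _ => a)) (j : Fin ℓ) : Pair α ρ (split Q j) := by
  refine ⟨fun x y => hQ.1 _, ?_, fun x => ?_, fun u v => ?_⟩
  · rw [← hQ.2, sum_ins j]; rfl
  · refine (hlb x).trans ?_
    have : Q (fun _ => x) = split Q j x (fun _ => x) := by
      unfold split; congr 1; funext k; simp [ins]
    rw [this]
    exact Finset.single_le_sum (f := fun y => split Q j x y) (fun y _ => hQ.1 _)
      (Finset.mem_univ _)
  · have h := cov_le hQ hρ0 hr j (F := fun z => u (z j)) (G := fun z => v (fun k => z k.1))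
      (by intro x y h; simp only [h j (Finset.mem_singleton_self j)])
      (by
        intro x y h
        have : (fun k : {k : Fin ℓ // k ≠ j} => x k.1) = fun k => y k.1 := by
          funext k; exact h k.1 (by simpa using k.2)
        simp only [this])
    have hv : ∀ x y, (fun k : {k : Fin ℓ // k ≠ j} => ins j y x k.1) = (y : _ → Ω) := by
      intro x y; funext k; exact ins_ne j y x k.1 k.2
    have eX : ∀ w : Ω → ℝ, ∑ x, ∑ y, Q (ins j y x) * w x = ∑ x, mX (split Q j) x * w x := by
      intro w; refine Finset.sum_congr rfl fun x _ => ?_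
      rw [mX, Finset.sum_mul]; rfl
    have eY : ∀ w : ({k : Fin ℓ // k ≠ j} → Ω) → ℝ,
        ∑ x, ∑ y, Q (ins j y x) * w y = ∑ y, mY (split Q j) y * w y := by
      intro w; rw [Finset.sum_comm]; refine Finset.sum_congr rfl fun x _ => ?_
      rw [mY, Finset.sum_mul]; rfl
    simp only [varP, covP, expP, sum_ins j, ins_self, hv] at h
    have e1 := eX (fun x => u x * u x)
    have e2 := eY (fun y => v y * v y)
    rw [eX u, eY v, e1, e2] at h
    simp only [← sq] at h
    exact h

end correlation

/-! ### Induction over the steps -/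

section steps

variable {Ω : Type} [Fintype Ω] {ℓ n : ℕ}

/-- Splitting tuples at step `j`. -/
def splitEquiv (j : Fin ℓ) : ((Fin n → Ω) × (Fin n → {k : Fin ℓ // k ≠ j} → Ω)) ≃
    (Fin n → Fin ℓ → Ω) where
  toFun p i := ins j (p.2 i) (p.1 i)
  invFun z := (fun i => z i j, fun i k => z i k.1)
  left_inv p := by
    refine Prod.ext ?_ ?_
    · funext i; exact ins_self _ _ _
    · funext i k; exact ins_ne _ _ _ _ k.2
  right_inv z := by
    funext i k
    by_cases h : k = j
    · subst h; exact ins_self _ _ _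
    · exact ins_ne _ _ _ _ h

lemma ev_split {Q : Fin n → (Fin ℓ → Ω) → ℝ} {α ρ : ℝ} (hα : 0 < α) (j : Fin ℓ)
    (hP : ∀ i, Pair α ρ (split (Q i) j)) (u : (Fin n → Ω) → ℝ)
    (g : (Fin n → {k : Fin ℓ // k ≠ j} → Ω) → ℝ) :
    ev Q (fun z => u (fun i => z i j) * g (fun i k => z i k.1))
      = ev (pX (fun i => split (Q i) j)) (fun x => u x * op (fun i => Cc (split (Q i) j)) g x) := by
  unfold ev
  rw [← (splitEquiv j).sum_comp, Fintype.sum_prod_type]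
  refine Finset.sum_congr rfl fun x _ => ?_
  unfold op
  simp only [Finset.mul_sum]
  refine Finset.sum_congr rfl fun y _ => ?_
  have e1 : (fun i => splitEquiv j (x, y) i j) = x := by
    funext i; exact ins_self _ _ _
  have e2 : (fun i (k : {k : Fin ℓ // k ≠ j}) => splitEquiv j (x, y) i k.1) = y := by
    funext i k; exact ins_ne _ _ _ _ k.2
  rw [e1, e2]
  have e3 : ∏ i, Q i (splitEquiv j (x, y) i)
      = (∏ i, pX (fun i => split (Q i) j) i (x i)) * ∏ i, Cc (split (Q i) j) (x i) (y i) := by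
    rw [← Finset.prod_mul_distrib]
    exact Finset.prod_congr rfl fun i _ => ((hP i).mX_Cc hα (x i) (y i)).symm
  rw [e3]; ring

lemma steps (ℓ : ℕ) {α ρ μ0 : ℝ} (hα : 0 < α) (hρ0 : 0 ≤ ρ) (hρ1 : ρ < 1) (hμ : 0 < μ0)
    (A : Finset (Fin ℓ)) : ∃ (k : ℕ) (δ : ℝ), 0 < δ ∧ ∀ (n : ℕ) (Ω : Type) [Fintype Ω]
      (Q : Fin n → (Fin ℓ → Ω) → ℝ) (π : Fin n → Ω → ℝ), (∀ i, IsDist (Q i)) →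
      (∀ i, HasMarginals (Q i) (π i)) → (∀ i a, α ≤ Q i (fun _ => a)) → (∀ i, rho (Q i) ≤ ρ) →
      ∀ f : (Fin n → Ω) → ℝ, (∀ v, f v ∈ Set.Icc (0:ℝ) 1) → LowRes π μ0 k f →
      δ ≤ ev Q (fun z => ∏ j ∈ A, f (fun i => z i j)) := by
  induction A using Finset.induction_on with
  | empty =>
    refine ⟨0, 1, one_pos, ?_⟩
    intro n Ω _ Q π hQ _ _ _ f _ _
    simp only [Finset.prod_empty]
    rw [ev_const fun i => (hQ i).2]
  | insert j A hj ih =>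
    obtain ⟨k, δ, hδ, ih⟩ := ih
    obtain ⟨B, ε, hε, hit⟩ := hitting hα hρ0 hρ1 hμ hδ
    refine ⟨max k B, ε, hε, ?_⟩
    intro n Ω _ Q π hQ hM hlb hr f hf hres
    have hP : ∀ i, Pair α ρ (split (Q i) j) := fun i => pair_split (hQ i) hρ0 (hr i) (hlb i) j
    have hπ : pX (fun i => split (Q i) j) = π := by
      funext i a; exact (mX_split j a).trans (hM i j a)
    set g : (Fin n → {k : Fin ℓ // k ≠ j} → Ω) → ℝ := fun y =>
      ∏ k : {k // k ∈ A}, f (fun i => y i ⟨k.1, fun h => hj (h ▸ k.2)⟩) with hg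
    have hgA : ∀ z : Fin n → Fin ℓ → Ω, g (fun i k => z i k.1) = ∏ k ∈ A, f (fun i => z i k) := by
      intro z
      rw [hg]
      exact Finset.prod_coe_sort A (fun k => f (fun i => z i k))
    have hg01 : ∀ y, g y ∈ Set.Icc (0:ℝ) 1 := fun y =>
      ⟨Finset.prod_nonneg fun k _ => (hf _).1,
        Finset.prod_le_one (fun k _ => (hf _).1) fun k _ => (hf _).2⟩
    have hmean : δ ≤ ev (fun i => mY (split (Q i) j)) g := by
      have h1 := ih n Ω Q π hQ hM hlb hr f hf (hres.mono (le_max_left _ _))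
      have h2 := ev_split hα j hP (fun _ => 1) g
      simp only [one_mul, hgA] at h2
      rw [h2] at h1
      refine h1.trans (le_of_eq ?_)
      have := ev_op (pX (fun i => split (Q i) j)) (fun i => Cc (split (Q i) j)) g
      refine this.trans ?_
      congr 1
      funext i y
      exact Finset.sum_congr rfl fun x _ => (hP i).mX_Cc hα x y
    have h3 := hit n Ω _ (fun i => split (Q i) j) hP f g hf hg01
      (by rw [hπ]; exact hres.mono (le_max_right _ _)) hmean
    rw [← ev_split hα j hP] at h3
    refine h3.trans (le_of_eq ?_)
    congr 1
    funext z
    rw [Finset.prod_insert hj, hgA]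

end steps

/-! ### Resilience and the product theorem -/

section resilience

variable {Ω : Type} [Fintype Ω] {ℓ n : ℕ}

/-- All restrictions of size at most `k` have mean at most `c`. -/
def HighRes (π : Fin n → Ω → ℝ) (c : ℝ) : ℕ → ((Fin n → Ω) → ℝ) → Prop
  | 0, f => ev π f ≤ c
  | k + 1, f => ev π f ≤ c ∧ ∀ i a, HighRes π c k (fun z => f (Function.update z i a))

lemma HighRes.mean {π : Fin n → Ω → ℝ} {c : ℝ} {k : ℕ} {f : (Fin n → Ω) → ℝ}
    (h : HighRes π c k f) : ev π f ≤ c := by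
  cases k with
  | zero => exact h
  | succ k => exact h.1

lemma LowRes.anti {π : Fin n → Ω → ℝ} {μ0 μ1 : ℝ} (hμ : μ0 ≤ μ1) : ∀ {k : ℕ}
    {f : (Fin n → Ω) → ℝ} (_ : LowRes π μ1 k f), LowRes π μ0 k f := by
  intro k
  induction k with
  | zero => intro f h; exact hμ.trans h
  | succ k ih => intro f h; exact ⟨hμ.trans h.1, fun i a => ih (h.2 i a)⟩

lemma low_of_high {π : Fin n → Ω → ℝ} (hπ : IsP π) {α c : ℝ} (hα : 0 < α) (hα1 : α ≤ 1)
    (hlb : ∀ i a, α ≤ π i a) (hc : 0 ≤ c) : ∀ (k : ℕ) (d : ℝ) (f : (Fin n → Ω) → ℝ),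
    d ≤ α ^ k / 2 → 0 ≤ d → HighRes π c k f → c * (1 - d) ≤ ev π f → LowRes π (c / 2) k f := by
  intro k
  induction k with
  | zero =>
    intro d f hd hd0 _ hm
    refine le_trans ?_ hm
    simp only [pow_zero] at hd
    nlinarith
  | succ k ih =>
    intro d f hd hd0 hU hm
    have hp : α ^ (k + 1) ≤ 1 := pow_le_one₀ hα.le hα1
    refine ⟨le_trans (by nlinarith) hm, fun i a => ?_⟩
    refine ih (d / α) _ ?_ (by positivity) (hU.2 i a) ?_
    · rw [div_le_iff₀ hα]
      calc d ≤ _ := hd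
        _ = _ := by ring
    · have h1 := ev_eq_sum_upd hπ i f
      have h2 : ∑ b, π i b * ev π (fun z => f (Function.update z i b))
          ≤ π i a * ev π (fun z => f (Function.update z i a)) + (1 - π i a) * c := by
        classical
        rw [← Finset.add_sum_erase _ _ (Finset.mem_univ a)]
        have h3 : ∑ b ∈ Finset.univ.erase a, π i b = 1 - π i a := by
          rw [← hπ.2 i, ← Finset.add_sum_erase _ _ (Finset.mem_univ a)]; ring
        rw [← h3, Finset.sum_mul]
        gcongr with b _
        · exact hπ.1 i b
        · exact (hU.2 i b).mean
      set y := ev π (fun z => f (Function.update z i a)) with hy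
      have hpa : 0 < π i a := hα.trans_le (hlb i a)
      have h4 : π i a * (c - y) ≤ c * d := by nlinarith
      have h5 : c * d = α * (c * (d / α)) := by field_simp
      have h6 : α * (c * (d / α)) ≤ π i a * (c * (d / α)) :=
        mul_le_mul_of_nonneg_right (hlb i a) (by positivity)
      have h7 : c - y ≤ c * (d / α) := by
        by_contra hcon
        push Not at hcon
        nlinarith [mul_lt_mul_of_pos_left hcon hpa]
      linarith

/-- The expected product. -/
noncomputable def PE (Q : Fin n → (Fin ℓ → Ω) → ℝ) (f : (Fin n → Ω) → ℝ) : ℝ :=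
  ev Q (fun z => ∏ j, f (fun i => z i j))

lemma PE_nonneg {Q : Fin n → (Fin ℓ → Ω) → ℝ} (hQ : IsP Q) {f : (Fin n → Ω) → ℝ}
    (hf : ∀ v, f v ∈ Set.Icc (0:ℝ) 1) : 0 ≤ PE Q f :=
  ev_nonneg hQ.1 fun z => Finset.prod_nonneg fun j _ => (hf _).1

lemma PE_upd {Q : Fin n → (Fin ℓ → Ω) → ℝ} (hQ : IsP Q) {α : ℝ}
    (hlb : ∀ i a, α ≤ Q i (fun _ => a)) {f : (Fin n → Ω) → ℝ}
    (hf : ∀ v, f v ∈ Set.Icc (0:ℝ) 1) (i : Fin n) (a : Ω) :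
    α * PE Q (fun v => f (Function.update v i a)) ≤ PE Q f := by
  refine le_trans ?_ (ev_upd_le hQ i (G := fun z => ∏ j, f (fun i => z i j))
    (fun z => Finset.prod_nonneg fun j _ => (hf _).1) (fun _ => a))
  have e : ev Q (fun z => ∏ j, f (fun i' => Function.update z i (fun _ => a) i' j))
      = PE Q (fun v => f (Function.update v i a)) := by
    unfold PE
    congr 1
    funext z
    refine Finset.prod_congr rfl fun j _ => ?_
    congr 1
    funext i'
    by_cases h : i' = i
    · subst h; simp
    · simp [h]
  rw [e]
  exact mul_le_mul_of_nonneg_right (hlb i a) (PE_nonneg hQ fun v => hf _)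

lemma exists_of_not_high {Q : Fin n → (Fin ℓ → Ω) → ℝ} (hQ : IsP Q) {π : Fin n → Ω → ℝ} {α c : ℝ}
    (hα : 0 < α) (hα1 : α ≤ 1) (hlb : ∀ i a, α ≤ Q i (fun _ => a)) :
    ∀ (k : ℕ) (f : (Fin n → Ω) → ℝ), (∀ v, f v ∈ Set.Icc (0:ℝ) 1) → ¬ HighRes π c k f →
    ∃ f' : (Fin n → Ω) → ℝ, (∀ v, f' v ∈ Set.Icc (0:ℝ) 1) ∧ c < ev π f' ∧
      α ^ k * PE Q f' ≤ PE Q f := by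
  intro k
  induction k with
  | zero =>
    intro f hf h
    exact ⟨f, hf, not_le.1 h, by simp⟩
  | succ k ih =>
    intro f hf h
    by_cases h1 : ev π f ≤ c
    · have h2 : ¬ ∀ i a, HighRes π c k (fun z => f (Function.update z i a)) := fun h2 => h ⟨h1, h2⟩
      push Not at h2
      obtain ⟨i, a, h2⟩ := h2
      obtain ⟨f', hf', hc, hle⟩ := ih _ (fun v => hf _) h2
      refine ⟨f', hf', hc, ?_⟩
      have := PE_upd hQ hlb hf i a
      calc α ^ (k + 1) * PE Q f' = α * (α ^ k * PE Q f') := by ring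
        _ ≤ α * PE Q (fun z => f (Function.update z i a)) := mul_le_mul_of_nonneg_left hle hα.le
        _ ≤ _ := this
    · refine ⟨f, hf, not_le.1 h1, ?_⟩
      exact mul_le_of_le_one_left (PE_nonneg hQ hf) (pow_le_one₀ hα.le hα1)

lemma product_theorem (ℓ : ℕ) (hℓ : 0 < ℓ) {α ρ μ : ℝ} (hα : 0 < α) (hα1 : α ≤ 1) (hρ0 : 0 ≤ ρ)
    (hρ1 : ρ < 1) (hμ : 0 < μ) : ∃ δ : ℝ, 0 < δ ∧ ∀ (n : ℕ) (Ω : Type) [Fintype Ω]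
      (Q : Fin n → (Fin ℓ → Ω) → ℝ) (π : Fin n → Ω → ℝ), (∀ i, IsDist (Q i)) →
      (∀ i, HasMarginals (Q i) (π i)) → (∀ i a, α ≤ Q i (fun _ => a)) → (∀ i, rho (Q i) ≤ ρ) →
      IsP π ∧ ∀ f : (Fin n → Ω) → ℝ, (∀ v, f v ∈ Set.Icc (0:ℝ) 1) → μ ≤ ev π f →
      δ ≤ PE Q f := by
  obtain ⟨k, δ0, hδ0, hst⟩ := steps ℓ hα hρ0 hρ1 (half_pos hμ) Finset.univ
  set d : ℝ := α ^ k / 2 with hd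
  have hαk : 0 < α ^ k := by positivity
  have hαk1 : α ^ k ≤ 1 := pow_le_one₀ hα.le hα1
  have hd0 : 0 < d := by positivity
  have hd1 : 0 < 1 - d := by linarith
  obtain ⟨T, hT⟩ := exists_pow_lt_of_lt_one hμ (show 1 - d < 1 by linarith)
  refine ⟨(α ^ k) ^ T * δ0, by positivity, ?_⟩
  intro n Ω _ Q π hQ hM hlb hr
  have hQP : IsP Q := ⟨fun i => (hQ i).1, fun i => (hQ i).2⟩
  have hP : ∀ i, Pair α ρ (split (Q i) ⟨0, hℓ⟩) :=
    fun i => pair_split (hQ i) hρ0 (hr i) (hlb i) _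
  have hπe : pX (fun i => split (Q i) ⟨0, hℓ⟩) = π := by
    funext i a; exact (mX_split _ a).trans (hM i _ a)
  have hπ : IsP π := hπe ▸ isP_pX hα hP
  have hπlb : ∀ i a, α ≤ π i a := by
    intro i a; rw [← hπe]; exact (hP i).lb a
  refine ⟨hπ, ?_⟩
  have main : ∀ (t : ℕ) (f : (Fin n → Ω) → ℝ), (∀ v, f v ∈ Set.Icc (0:ℝ) 1) → μ ≤ ev π f →
      (1 - d) ^ t < ev π f → (α ^ k) ^ t * δ0 ≤ PE Q f := by
    intro t
    induction t with
    | zero =>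
      intro f hf _ h
      exfalso
      have := ev_mono hπ.1 (fun z => (hf z).2)
      rw [ev_const hπ.2] at this
      simp only [pow_zero] at h
      linarith
    | succ t ih =>
      intro f hf hm h
      set c := ev π f / (1 - d) with hc
      have hcm : ev π f = c * (1 - d) := by rw [hc]; field_simp
      have hc0 : 0 < c := div_pos (hμ.trans_le hm) hd1
      have hmc : μ ≤ c := by nlinarith
      by_cases hU : HighRes π c k f
      · have h1 := low_of_high hπ hα hα1 hπlb hc0.le k d f le_rfl hd0.le hU hcm.symm.le
        have h2 := hst n Ω Q π hQ hM hlb hr f hf (h1.anti (by linarith))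
        refine le_trans ?_ h2
        exact mul_le_of_le_one_left hδ0.le (pow_le_one₀ hαk.le hαk1)
      · obtain ⟨f', hf', hc', hle⟩ := exists_of_not_high hQP hα hα1 hlb k f hf hU
        have h3 : (1 - d) ^ t < c := by
          rw [hc, lt_div_iff₀ hd1, ← pow_succ]; exact h
        have := ih f' hf' (hmc.trans hc'.le) (h3.trans hc')
        calc (α ^ k) ^ (t + 1) * δ0 = α ^ k * ((α ^ k) ^ t * δ0) := by ring
          _ ≤ α ^ k * PE Q f' := mul_le_mul_of_nonneg_left this hαk.le
          _ ≤ _ := hle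
  intro f hf hm
  exact main T f hf hm (hT.trans_le hm)

lemma ev_mix {A : Type} [Fintype A] {r : ℕ} (β : Fin r → ℝ) (R : Fin r → A → ℝ)
    (G : (Fin n → A) → ℝ) : ev (fun _ a => ∑ k, β k * R k a) G
      = ∑ κ : Fin n → Fin r, (∏ i, β (κ i)) * ev (fun i => R (κ i)) G := by
  simp only [ev, Finset.mul_sum]
  rw [Finset.sum_comm]
  refine Finset.sum_congr rfl fun z _ => ?_
  rw [Finset.prod_univ_sum, Fintype.piFinset_univ, Finset.sum_mul]
  refine Finset.sum_congr rfl fun κ _ => ?_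
  rw [Finset.prod_mul_distrib]; ring

lemma prodExp_eq (P : (Fin ℓ → Ω) → ℝ) (f : (Fin n → Ω) → ℝ) :
    prodExp P (fun _ => f) = PE (fun _ : Fin n => P) f := by
  unfold prodExp PE ev
  rw [← (Equiv.piComm (fun (_ : Fin n) (_ : Fin ℓ) => Ω)).sum_comp]
  rfl

lemma marginal_mix {r : ℕ} (β : Fin r → ℝ) (Q : Fin r → (Fin ℓ → Ω) → ℝ) {P : (Fin ℓ → Ω) → ℝ}
    (hP : ∀ x, P x = ∑ k, β k * Q k x) (j : Fin ℓ) (a : Ω) :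
    marginal P j a = ∑ k, β k * marginal (Q k) j a := by
  unfold marginal
  simp only [Finset.mul_sum]
  rw [Finset.sum_comm]
  refine Finset.sum_congr rfl fun x _ => ?_
  split_ifs
  · exact hP x
  · simp

end resilience

/-- distributions with an `(α, ρ)`-convex decomposition are
same-set hitting. -/
theorem convex_decomposition_same_set_hitting :
    ∀ ℓ : ℕ, 2 ≤ ℓ →
    ∀ α ρ μ : ℝ, α ∈ Set.Ioc (0:ℝ) 1 → ρ ∈ Set.Ico (0:ℝ) 1 →
      μ ∈ Set.Ioc (0:ℝ) 1 →
    ∃ δ : ℝ, 0 < δ ∧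
      ∀ (Ω : Type) [Fintype Ω],
      ∀ (P : (Fin ℓ → Ω) → ℝ) (π : Ω → ℝ),
        IsDist P → HasMarginals P π →
        HasConvexDecomp P α ρ →
        ∀ n : ℕ, 1 ≤ n →
        ∀ f : (Fin n → Ω) → ℝ, (∀ v, f v ∈ Set.Icc (0:ℝ) 1) →
          exps π f = μ →
          δ ≤ prodExp P (fun _ => f) := by
  intro ℓ hℓ α ρ μ hα hρ hμ
  have hμ0 : 0 < μ := hμ.1
  have hℓ0 : 0 < ℓ := by omega
  obtain ⟨δ, hδ, hth⟩ := product_theorem ℓ hℓ0 hα.1 hα.2 hρ.1 hρ.2 (half_pos hμ0)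
  refine ⟨δ * (μ / 2), by positivity, ?_⟩
  intro Ω _ P π hP hPm hdec n _ f hf hmean
  obtain ⟨r, β, Q, hβ, hβ1, hPQ, hQ, hQm, hQl, hQr⟩ := hdec
  choose π' hπ' using hQm
  have hπe : π = fun a => ∑ k, β k * π' k a := by
    funext a
    rw [← hPm ⟨0, hℓ0⟩ a, marginal_mix β Q hPQ]
    exact Finset.sum_congr rfl fun k _ => by rw [hπ' k]
  have hPe : P = fun x => ∑ k, β k * Q k x := funext hPQ
  have hm : ∑ κ : Fin n → Fin r, (∏ i, β (κ i)) * ev (fun i => π' (κ i)) f = μ := by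
    rw [← ev_mix, ← hmean, hπe]; rfl
  have hw : ∑ κ : Fin n → Fin r, ∏ i, β (κ i) = 1 := by
    rw [sum_prod_pi (fun _ : Fin n => β)]; simp [hβ1]
  have hκ : ∀ κ : Fin n → Fin r, δ * (ev (fun i => π' (κ i)) f - μ / 2)
      ≤ PE (fun i => Q (κ i)) f := by
    intro κ
    obtain ⟨hp, h⟩ := hth n Ω (fun i => Q (κ i)) (fun i => π' (κ i)) (fun i => hQ _)
      (fun i => hπ' _) (fun i => hQl _) (fun i => hQr _)
    by_cases hc : μ / 2 ≤ ev (fun i => π' (κ i)) f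
    · refine le_trans ?_ (h f hf hc)
      have h1 := ev_mono hp.1 (fun z => (hf z).2)
      rw [ev_const hp.2] at h1
      exact mul_le_of_le_one_right hδ.le (by linarith)
    · push Not at hc
      refine le_trans ?_ (PE_nonneg ⟨fun i => (hQ _).1, fun i => (hQ _).2⟩ hf)
      exact (mul_neg_of_pos_of_neg hδ (by linarith)).le
  rw [prodExp_eq, hPe]
  unfold PE
  rw [ev_mix β Q]
  calc δ * (μ / 2) = ∑ κ : Fin n → Fin r,
        (∏ i, β (κ i)) * (δ * (ev (fun i => π' (κ i)) f - μ / 2)) := by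
        have : ∀ κ : Fin n → Fin r, (∏ i, β (κ i)) * (δ * (ev (fun i => π' (κ i)) f - μ / 2))
          = δ * ((∏ i, β (κ i)) * ev (fun i => π' (κ i)) f) - δ * (μ / 2) * ∏ i, β (κ i) := by
          intro κ; ring
        simp only [this]
        rw [Finset.sum_sub_distrib, ← Finset.mul_sum, ← Finset.mul_sum, hm, hw]; ring
    _ ≤ _ := Finset.sum_le_sum fun κ _ =>
        mul_le_mul_of_nonneg_left (hκ κ) (Finset.prod_nonneg fun i _ => (hβ _).le)

end SameSetHitting
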